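/- arXiv:1210.2450 — 6 statements merged into one kernel-verified Lean document; each statement's English description precedes it below -/
import Mathlib

section
/- For every game graph H = (S, S1, S2, E, sι) and every weight function ω : E → ℤ, the limit-average game is determined: sup_{π1∈Π1} inf_{π2∈Π2} LimAvg(Out_H(π1,π2)) = inf_{π2∈Π2} sup_{π1∈Π1} LimAvg(Out_H(π1,π2)); moreover there exist memoryless optimal strategies for both players, i.e., a memoryless Player-1 strategy π1* with inf_{π2∈Π2} LimAvg(Out_H(π1*,π2)) equal to this common value, and a memoryless Player-2 strategy π2* with sup_{π1∈Π1} LimAvg(Out_H(π1,π2*)) equal to this common value. -/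
open scoped Classical

/-! ### Game graphs, strategies, plays, objectives -/

/-- A two-player game graph: a set of states partitioned into Player-1 states `S1`
and Player-2 states `S2`, an edge relation `E` in which every state has at least one
outgoing edge, and an initial state `init`. -/
structure GameGraph (S : Type) where
  S1 : Set S
  S2 : Set S
  partition : ∀ s, s ∈ S1 ↔ s ∉ S2
  E : S → S → Prop
  init : S
  serial : ∀ s, ∃ t, E s t

/-- A strategy for the player owning the states in `P`: given the history `w` and the
current state `s ∈ P`, it chooses a successor along an edge. -/
structure Strat {S : Type} (H : GameGraph S) (P : Set S) where
  f : List S → S → S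
  valid : ∀ w s, s ∈ P → H.E s (f w s)

/-- A strategy is memoryless (positional) if its choice does not depend on the history. -/
def Strat.Memoryless {S : Type} {H : GameGraph S} {P : Set S} (π : Strat H P) : Prop :=
  ∀ w w' s, π.f w s = π.f w' s

/-- Auxiliary: the pair (history, current state) after `n` steps when Player 1 plays `π1`
and Player 2 plays `π2`. -/
noncomputable def GameGraph.hist {S : Type} (H : GameGraph S)
    (π1 : Strat H H.S1) (π2 : Strat H H.S2) : ℕ → List S × S
  | 0 => ([], H.init)
  | n + 1 =>
      let p := GameGraph.hist H π1 π2 n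
      (p.1 ++ [p.2], if p.2 ∈ H.S1 then π1.f p.1 p.2 else π2.f p.1 p.2)

/-- The unique play `Out_H(π1, π2)` conformant to both strategies. -/
noncomputable def GameGraph.outcome {S : Type} (H : GameGraph S)
    (π1 : Strat H H.S1) (π2 : Strat H H.S2) : ℕ → S :=
  fun n => (H.hist π1 π2 n).2

/-- A play of the game graph: an infinite sequence of states starting at the initial state
and following edges. -/
def GameGraph.IsPlay {S : Type} (H : GameGraph S) (ρ : ℕ → S) : Prop :=
  ρ 0 = H.init ∧ ∀ n, H.E (ρ n) (ρ (n + 1))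

/-- A play `ρ` is conformant to a strategy `π` (of the player owning `P`) if at every
position in `P` the play follows the choice of `π`. -/
def Conformant {S : Type} {H : GameGraph S} {P : Set S} (π : Strat H P) (ρ : ℕ → S) : Prop :=
  ∀ n, ρ n ∈ P → ρ (n + 1) = π.f (List.ofFn fun i : Fin n => ρ i) (ρ n)

/-- The limit-average objective `LimAvg(ρ) = liminf (1/n)·Σ_{i<n} ω(ρ i, ρ (i+1))`. -/
noncomputable def limAvg {S : Type} (ω : S → S → ℤ) (ρ : ℕ → S) : ℝ :=
  Filter.liminf
    (fun n : ℕ => (∑ i ∈ Finset.range n, (ω (ρ i) (ρ (i + 1)) : ℝ)) / (n : ℝ))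
    Filter.atTop

/-- The discounted-sum objective `Disc_λ(ρ) = Σ_i λ^i · ω(ρ i, ρ (i+1))`. -/
noncomputable def disc {S : Type} (lam : ℝ) (ω : S → S → ℤ) (ρ : ℕ → S) : ℝ :=
  ∑' i : ℕ, lam ^ i * (ω (ρ i) (ρ (i + 1)) : ℝ)

/-- The lower value `sup_{π1} inf_{π2} f(Out(π1,π2))` of the game (in `EReal`). -/
noncomputable def GameGraph.supInf {S : Type} (H : GameGraph S) (f : (ℕ → S) → ℝ) : EReal :=
  ⨆ π1 : Strat H H.S1, ⨅ π2 : Strat H H.S2, ((f (H.outcome π1 π2) : ℝ) : EReal)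

/-- The upper value `inf_{π2} sup_{π1} f(Out(π1,π2))` of the game (in `EReal`). -/
noncomputable def GameGraph.infSup {S : Type} (H : GameGraph S) (f : (ℕ → S) → ℝ) : EReal :=
  ⨅ π2 : Strat H H.S2, ⨆ π1 : Strat H H.S1, ((f (H.outcome π1 π2) : ℝ) : EReal)

/-! ### Interface automata -/

/-- An interface automaton (transition system with input and output actions).
Broadcast interface automata (BIAs) are those satisfying `IA.IsBIA`; systems modified
by an error model are interface automata that need not be input-deterministic. -/
structure IA (Q : Type) (Act : Type) where
  init : Q
  AI : Set Act
  AO : Set Act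
  delta : Q → Act → Q → Prop

namespace IA

/-- `F` is a broadcast interface automaton: inputs and outputs are disjoint, transitions
are labeled by actions, and `F` is input-deterministic. -/
structure IsBIA {Q Act : Type} (F : IA Q Act) : Prop where
  disj : Disjoint F.AI F.AO
  dom : ∀ q a q', F.delta q a q' → a ∈ F.AI ∪ F.AO
  inputDet : ∀ q a q' q'', a ∈ F.AI → F.delta q a q' → F.delta q a q'' → q' = q''

/-- The input actions enabled at state `q` (written `AI(q)`). -/
def enabledI {Q Act : Type} (F : IA Q Act) (q : Q) : Set Act :=
  {a | a ∈ F.AI ∧ ∃ q', F.delta q a q'}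

/-- The output actions enabled at state `q` (written `AO(q)`). -/
def enabledO {Q Act : Type} (F : IA Q Act) (q : Q) : Set Act :=
  {a | a ∈ F.AO ∧ ∃ q', F.delta q a q'}

/-- `R` is an alternating simulation by `F` of `F'`. -/
def AltSim {Q Q' Act : Type} (F : IA Q Act) (F' : IA Q' Act) (R : Q → Q' → Prop) : Prop :=
  ∀ q q', R q q' →
    (∀ a ∈ F.AI, ∀ r, F.delta q a r → ∃ r', F'.delta q' a r' ∧ R r r') ∧
    (∀ a ∈ F'.AO, ∀ r', F'.delta q' a r' → ∃ r, F.delta q a r ∧ R r r')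

/-- `F'` refines `F`, written `F ⪰ F'`. -/
def Refines {Q Q' Act : Type} (F : IA Q Act) (F' : IA Q' Act) : Prop :=
  F.AI ⊆ F'.AI ∧ F'.AO ⊆ F.AO ∧ ∃ R, AltSim F F' R ∧ R F.init F'.init

end IA

/-! ### Error models and modified systems -/

/-- An error model on the action set `D` (the inputs, resp. the outputs): a partial
cost function (`none` plays the role of `⊥` = infinity) which is reflexive with cost `0`
and satisfies the triangle inequality. -/
structure ErrorModel (Act : Type) (D : Set Act) where
  M : Act → Act → Option ℕ
  dom : ∀ a b, M a b ≠ none → a ∈ D ∧ b ∈ D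
  refl : ∀ a ∈ D, M a a = some 0
  triangle : ∀ a b c x y, M a b = some x → M b c = some y → ∃ z, z ≤ x + y ∧ M a c = some z

namespace IA

/-- The modified system `F ⊗ M`: transitions on actions outside the domain of the error
model are kept, and a transition `(s, σ₂, t)` is added whenever there is `(s, σ₁, t) ∈ δ`
with `M(σ₁, σ₂) ≠ ⊥`. -/
def modify {Q Act : Type} {D : Set Act} (F : IA Q Act) (M : ErrorModel Act D) : IA Q Act where
  init := F.init
  AI := F.AI
  AO := F.AO
  delta := fun s b t => (b ∉ D ∧ F.delta s b t) ∨ ∃ a, F.delta s a t ∧ M.M a b ≠ none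

/-- The weight function `ω_M` of the modified system `F ⊗ M`:
`ω_M(s, σ₂, t) = min { M(σ₁,σ₂) | (s,σ₁,t) ∈ δ }` (and `0` on unmodified transitions). -/
noncomputable def mweight {Q Act : Type} {D : Set Act} (F : IA Q Act) (M : ErrorModel Act D) :
    Q → Act → Q → ℕ :=
  fun s b t => sInf {n : ℕ | ∃ a, F.delta s a t ∧ M.M a b = some n}

/-! ### Composition -/

/-- The action alphabet of `F`. -/
def acts {Q Act : Type} (F : IA Q Act) : Set Act := F.AI ∪ F.AO

/-- The shared actions of `F` and `G`. -/
def shared {Q R Act : Type} (F : IA Q Act) (G : IA R Act) : Set Act := F.acts ∩ G.acts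

/-- `F` and `G` are composable: their inputs do not mix, nor do their outputs. -/
def Composable {Q R Act : Type} (F : IA Q Act) (G : IA R Act) : Prop :=
  Disjoint F.AI G.AI ∧ Disjoint F.AO G.AO

/-- The product automaton `F ⊗ G`. -/
def prod {Q R Act : Type} (F : IA Q Act) (G : IA R Act) : IA (Q × R) Act where
  init := (F.init, G.init)
  AI := (F.AI ∪ G.AI) \ shared F G
  AO := F.AO ∪ G.AO
  delta := fun s σ t =>
    (σ ∉ shared F G ∧ F.delta s.1 σ t.1 ∧ s.2 = t.2) ∨
    (σ ∉ shared F G ∧ G.delta s.2 σ t.2 ∧ s.1 = t.1) ∨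
    (σ ∈ shared F G ∧ F.delta s.1 σ t.1 ∧ G.delta s.2 σ t.2)

/-- A state `(p, q)` of the product `F ⊗ G` is an error state. -/
def errorState {Q R Act : Type} (F : IA Q Act) (G : IA R Act) (s : Q × R) : Prop :=
  ∃ σ ∈ shared F G,
    (σ ∈ F.enabledO s.1 ∧ σ ∉ G.enabledI s.2) ∨
    (σ ∈ G.enabledO s.2 ∧ σ ∉ F.enabledI s.1)

/-- One step of the product using only output actions. -/
def outputStep {Q R Act : Type} (F : IA Q Act) (G : IA R Act) (s t : Q × R) : Prop :=
  ∃ σ ∈ (F.prod G).AO, (F.prod G).delta s σ t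

/-- A product state is compatible if no error state is reachable from it using only
output actions. -/
def compatibleState {Q R Act : Type} (F : IA Q Act) (G : IA R Act) (s : Q × R) : Prop :=
  ∀ t, Relation.ReflTransGen (outputStep F G) s t → ¬ errorState F G t

/-- `F` and `G` are compatible (`F ∼ G`): the initial state of `F ⊗ G` is compatible. -/
def Compatible {Q R Act : Type} (F : IA Q Act) (G : IA R Act) : Prop :=
  compatibleState F G (F.init, G.init)

/-- The composition `F ∥ G`: the product restricted by removing input-action transitions
leading from compatible to incompatible states. -/
def par {Q R Act : Type} (F : IA Q Act) (G : IA R Act) : IA (Q × R) Act where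
  init := (F.init, G.init)
  AI := (F.prod G).AI
  AO := (F.prod G).AO
  delta := fun s σ t => (F.prod G).delta s σ t ∧
    ¬(σ ∈ (F.prod G).AI ∧ compatibleState F G s ∧ ¬ compatibleState F G t)

end IA

/-- The output error model `MO` is restricted with respect to `G` (for the component `F`):
for `σ₁ ≠ σ₂`, if `MO(σ₁,σ₂) ≠ ⊥` then `σ₂ ∈ AO_{F∥G} \ AO_G`. -/
def OutRestricted {Q R Act : Type} {DO : Set Act} (MO : ErrorModel Act DO)
    (F : IA Q Act) (G : IA R Act) : Prop :=
  ∀ a b, a ≠ b → MO.M a b ≠ none → b ∈ (F.par G).AO \ G.AO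

/-- The input error model `MI` is restricted with respect to `G` (for the component `F'`):
for `σ₁ ≠ σ₂`, if `MI(σ₁,σ₂) ≠ ⊥` then `σ₂ ∈ AI_{F'∥G} \ AI_G`. -/
def InRestricted {Q' R Act : Type} {DI : Set Act} (MI : ErrorModel Act DI)
    (F' : IA Q' Act) (G : IA R Act) : Prop :=
  ∀ a b, a ≠ b → MI.M a b ≠ none → b ∈ (F'.par G).AI \ G.AI

/-! ### The alternating simulation game -/

/-- States of the alternating simulation game for automata `X` (states `Q`) and
`Y` (states `Q'`): the error state `err`, Player-1 states `st q none q'` (the `#` states)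
and Player-2 states `st q (some σ) q'`. -/
inductive GS (Q Q' Act : Type)
  | err : GS Q Q' Act
  | st : Q → Option Act → Q' → GS Q Q' Act

/-- Player-2 states of the simulation game are those carrying an action to be matched. -/
def GS.isP2 {Q Q' Act : Type} : GS Q Q' Act → Prop
  | .st _ (some _) _ => True
  | _ => False

/-- The primary edges of the alternating simulation game `H_{X,Y}`:
Player 1 chooses an input transition of `X` or an output transition of `Y`;
Player 2 matches by an input transition of `Y` or an output transition of `X`. -/
def rawEdge {Q Q' Act : Type} (X : IA Q Act) (Y : IA Q' Act) :
    GS Q Q' Act → GS Q Q' Act → Prop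
  | .st s none s', .st t (some σ) t' =>
      (σ ∈ X.AI ∧ X.delta s σ t ∧ t' = s') ∨ (σ ∈ Y.AO ∧ Y.delta s' σ t' ∧ t = s)
  | .st s (some σ) s', .st t none t' =>
      (σ ∈ X.AI ∧ Y.delta s' σ t' ∧ t = s) ∨ (σ ∈ Y.AO ∧ X.delta s σ t ∧ t' = s')
  | _, _ => False

/-- The alternating simulation game `H_{X,Y}`: its edges are the primary edges, plus an
edge to `err` from every stuck Player-2 state, and a self-loop on every stuck Player-1
state (in particular on `err`). -/
def simGame {Q Q' Act : Type} (X : IA Q Act) (Y : IA Q' Act) : GameGraph (GS Q Q' Act) where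
  S1 := {s | ¬ s.isP2}
  S2 := {s | s.isP2}
  partition := fun _ => Iff.rfl
  E := fun x y => rawEdge X Y x y ∨
    (x.isP2 ∧ (∀ z, ¬ rawEdge X Y x z) ∧ y = GS.err) ∨
    (¬ x.isP2 ∧ (∀ z, ¬ rawEdge X Y x z) ∧ y = x)
  init := GS.st X.init none Y.init
  serial := by
    intro s
    by_cases h : ∃ z, rawEdge X Y s z
    · obtain ⟨z, hz⟩ := h
      exact ⟨z, Or.inl hz⟩
    · push_neg at h
      by_cases h2 : s.isP2
      · exact ⟨GS.err, Or.inr (Or.inl ⟨h2, h, rfl⟩)⟩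
      · exact ⟨s, Or.inr (Or.inr ⟨h2, h, rfl⟩)⟩

/-- The weights of the quantitative simulation game: edges leaving Player-1 states get
weight `0`, except around `err` where the weight is the maximal finite weight `W`; an edge
leaving a Player-2 state gets twice the weight of the matched transition (`wY` on the
matched input transition of `Y`, `wX` on the matched output transition of `X`). -/
noncomputable def gameWeight {Q Q' Act : Type} (X : IA Q Act)
    (wX : Q → Act → Q → ℕ) (wY : Q' → Act → Q' → ℕ) (W : ℕ) :
    GS Q Q' Act → GS Q Q' Act → ℤ :=
  fun x y =>
    match x, y with
    | .err, _ => (W : ℤ)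
    | _, .err => (W : ℤ)
    | .st s (some σ) s', .st t none t' =>
        if σ ∈ X.AI then 2 * (wY s' σ t' : ℤ) else 2 * (wX s σ t : ℤ)
    | _, _ => 0

/-- The maximal finite weight assigned by the two error models. -/
noncomputable def maxW {Act : Type} {DO DI : Set Act}
    (MO : ErrorModel Act DO) (MI : ErrorModel Act DI) : ℕ :=
  sSup {n : ℕ | (∃ a b, MO.M a b = some n) ∨ (∃ a b, MI.M a b = some n)}

/-- The interface simulation distance `d^{LimAvg}(F ⊗ MO, F' ⊗ MI)`: the value of the
quantitative simulation game `H_{F⊗MO, F'⊗MI}` with the limit-average objective. -/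
noncomputable def distLimAvg {Q Q' Act : Type} {DO DI : Set Act}
    (F : IA Q Act) (MO : ErrorModel Act DO) (F' : IA Q' Act) (MI : ErrorModel Act DI) :
    EReal :=
  (simGame (F.modify MO) (F'.modify MI)).supInf
    (limAvg (gameWeight (F.modify MO) (F.mweight MO) (F'.mweight MI) (maxW MO MI)))

/-- The interface simulation distance `d^{Disc_λ}(F ⊗ MO, F' ⊗ MI)`: the value of the
quantitative simulation game `H_{F⊗MO, F'⊗MI}` with the discounted-sum objective. -/
noncomputable def distDisc {Q Q' Act : Type} {DO DI : Set Act} (lam : ℝ)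
    (F : IA Q Act) (MO : ErrorModel Act DO) (F' : IA Q' Act) (MI : ErrorModel Act DI) :
    EReal :=
  (simGame (F.modify MO) (F'.modify MI)).supInf
    (disc lam (gameWeight (F.modify MO) (F.mweight MO) (F'.mweight MI) (maxW MO MI)))

/-! ### Abstractions -/

namespace IA

/-- The `∀∃` abstraction of `F` with respect to an equivalence relation on its states:
input transitions are abstracted universally, output transitions existentially. -/
def absFE {Q Act : Type} (F : IA Q Act) (s : Setoid Q) : IA (Quotient s) Act where
  init := Quotient.mk s F.init
  AI := F.AI
  AO := F.AO
  delta := fun c σ c' =>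
    (σ ∈ F.AI ∧ ∀ q, Quotient.mk s q = c → ∃ q', Quotient.mk s q' = c' ∧ F.delta q σ q') ∨
    (σ ∈ F.AO ∧ ∃ q q', Quotient.mk s q = c ∧ Quotient.mk s q' = c' ∧ F.delta q σ q')

/-- The `∃∀` abstraction of `F` with respect to an equivalence relation on its states:
input transitions are abstracted existentially, output transitions universally. -/
def absEF {Q Act : Type} (F : IA Q Act) (s : Setoid Q) : IA (Quotient s) Act where
  init := Quotient.mk s F.init
  AI := F.AI
  AO := F.AO
  delta := fun c σ c' =>
    (σ ∈ F.AI ∧ ∃ q q', Quotient.mk s q = c ∧ Quotient.mk s q' = c' ∧ F.delta q σ q') ∨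
    (σ ∈ F.AO ∧ ∀ q, Quotient.mk s q = c → ∃ q', Quotient.mk s q' = c' ∧ F.delta q σ q')

end IA

section Aux
open Filter Topology

theorem aux_opt {S : Type} [Finite S] (H : GameGraph S) (s : S) (q : S → ℝ) :
    ∃ t, H.E s t ∧ (s ∈ H.S1 → ∀ t', H.E s t' → q t' ≤ q t) ∧
      (s ∉ H.S1 → ∀ t', H.E s t' → q t ≤ q t') := by
  have hf : {t | H.E s t}.Finite := Set.toFinite _
  have hn : {t | H.E s t}.Nonempty := H.serial s
  by_cases h : s ∈ H.S1
  · obtain ⟨t, ht, hm⟩ := Set.exists_max_image _ q hf hn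
    exact ⟨t, ht, fun _ => hm, fun h' => absurd h h'⟩
  · obtain ⟨t, ht, hm⟩ := Set.exists_min_image _ q hf hn
    exact ⟨t, ht, fun h' => absurd h' h, fun _ => hm⟩

theorem aux_disc {S : Type} [Fintype S] (H : GameGraph S) (w : S → S → ℝ) (W : ℝ)
    (hW : ∀ s t, |w s t| ≤ W) (l : ℝ) (h0 : 0 < l) (h1 : l < 1) :
    ∃ u : S → ℝ, (∀ s, |u s| ≤ W) ∧ ∀ s, ∃ t, H.E s t ∧
      u s = (1 - l) * w s t + l * u t ∧
      (s ∈ H.S1 → ∀ t', H.E s t' → (1 - l) * w s t' + l * u t' ≤ u s) ∧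
      (s ∉ H.S1 → ∀ t', H.E s t' → u s ≤ (1 - l) * w s t' + l * u t') := by
  choose c hc1 hc2 hc3 using fun s q => aux_opt H s q
  let Q : (S → ℝ) → S → S → ℝ := fun u s t => (1 - l) * w s t + l * u t
  let T : (S → ℝ) → S → ℝ := fun u s => Q u s (c s (Q u s))
  have key : ∀ u v : S → ℝ, ∀ s, T u s ≤ T v s + l * dist u v := by
    intro u v s
    have hq : ∀ t, Q u s t ≤ Q v s t + l * dist u v := by
      intro t
      have h := (le_abs_self _).trans ((Real.dist_eq _ _).symm.le.trans (dist_le_pi_dist u v t))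
      have := mul_le_mul_of_nonneg_left h h0.le
      simp only [Q]; linarith
    by_cases h : s ∈ H.S1
    · exact (hq _).trans (by have := hc2 s (Q v s) h _ (hc1 s (Q u s)); simp only [T]; linarith)
    · exact (hc3 s (Q u s) h _ (hc1 s (Q v s))).trans (hq _)
  have hT : ContractingWith ⟨l, h0.le⟩ T := by
    refine ⟨h1, LipschitzWith.of_dist_le_mul fun u v => ?_⟩
    refine (dist_pi_le_iff (by positivity)).2 fun s => ?_
    rw [Real.dist_eq, abs_le]
    have a := key u v s
    have b := key v u s
    rw [dist_comm] at b
    constructor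
    · change -(l * dist u v) ≤ _
      linarith
    · change _ ≤ l * dist u v
      linarith
  obtain ⟨u, hu⟩ : ∃ u, T u = u := ⟨_, hT.fixedPoint_isFixedPt⟩
  have hus : ∀ s, u s = Q u s (c s (Q u s)) := fun s => (congrFun hu s).symm
  refine ⟨u, ?_, fun s => ⟨c s (Q u s), hc1 _ _, hus s, fun h t' ht' => ?_, fun h t' ht' => ?_⟩⟩
  · intro s
    have hn : ‖u‖ ≤ (1 - l) * W + l * ‖u‖ := by
      have hW0 : 0 ≤ W := (abs_nonneg _).trans (hW s s)
      have hl : 0 ≤ 1 - l := by linarith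
      refine (pi_norm_le_iff_of_nonneg (by positivity)).2 fun s => ?_
      rw [hus s]
      refine (norm_add_le _ _).trans ?_
      rw [norm_mul, norm_mul, Real.norm_of_nonneg hl, Real.norm_of_nonneg h0.le]
      gcongr
      · exact hW _ _
      · exact norm_le_pi_norm u _
    have := norm_le_pi_norm u s
    rw [Real.norm_eq_abs] at this
    have : ‖u‖ ≤ W := by nlinarith
    linarith
  · rw [hus s]; exact hc2 s (Q u s) h _ ht'
  · rw [hus s]; exact hc3 s (Q u s) h _ ht'

theorem aux_core {S : Type} [Finite S] (w : S → S → ℝ) (F : Filter ℝ) [NeBot F]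
    (hF : F ≤ 𝓝[<] 1) (u : ℝ → S → ℝ) (v : S → ℝ)
    (huv : ∀ s, Tendsto (fun l => u l s) F (𝓝 (v s)))
    (ρ : ℕ → S)
    (hρ : ∀ᶠ l in F, ∀ n, u l (ρ n) ≤ (1 - l) * w (ρ n) (ρ (n + 1)) + l * u l (ρ (n + 1)))
    (ε : ℝ) (hε : 0 < ε) :
    ∀ᶠ n : ℕ in atTop, v (ρ 0) - ε ≤ (∑ i ∈ Finset.range n, w (ρ i) (ρ (i + 1))) / (n : ℝ) := by
  have hid : Tendsto (fun l : ℝ => l) F (𝓝 1) := (hF.trans nhdsWithin_le_nhds)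
  have hmono : ∀ n, v (ρ n) ≤ v (ρ (n + 1)) := by
    intro n
    have h2 : Tendsto (fun l => (1 - l) * w (ρ n) (ρ (n + 1)) + l * u l (ρ (n + 1))) F
        (𝓝 ((1 - 1) * w (ρ n) (ρ (n + 1)) + 1 * v (ρ (n + 1)))) :=
      ((tendsto_const_nhds.sub hid).mul_const _).add (hid.mul (huv _))
    have := le_of_tendsto_of_tendsto (huv (ρ n)) h2 (hρ.mono fun l h => h n)
    linarith
  have hm : Monotone (fun n => v (ρ n)) := monotone_nat_of_le_succ hmono
  have hlt : ∀ᶠ l in F, l < 1 := hF self_mem_nhdsWithin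
  have hpos : ∀ᶠ l in F, 0 < l := hid.eventually (lt_mem_nhds one_pos)
  have hclose : ∀ᶠ l in F, ∀ s, v s - ε / 2 < u l s :=
    eventually_all.2 fun s => (huv s).eventually (lt_mem_nhds (by linarith))
  obtain ⟨l, hl, hl1, hl0, hc⟩ := (hρ.and (hlt.and (hpos.and hclose))).exists
  obtain ⟨B, hB⟩ : ∃ B, ∀ s, |u l s| ≤ B := by
    obtain ⟨B, hB⟩ := (Set.finite_range (fun s => |u l s|)).bddAbove
    exact ⟨B, fun s => hB ⟨s, rfl⟩⟩
  have hsum : ∀ n : ℕ, (1 - l) * (n * (v (ρ 0) - ε / 2)) + l * (u l (ρ 0) - u l (ρ n)) ≤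
      (1 - l) * ∑ i ∈ Finset.range n, w (ρ i) (ρ (i + 1)) := by
    intro n
    induction n with
    | zero => simp
    | succ n ih =>
      rw [Finset.sum_range_succ, mul_add]
      have h1 := hl n
      have h2 := hc (ρ n)
      have h3 : v (ρ 0) ≤ v (ρ n) := hm (Nat.zero_le n)
      have h4 : (1 - l) * (v (ρ 0) - ε / 2) ≤ (1 - l) * u l (ρ n) :=
        mul_le_mul_of_nonneg_left (by linarith) (by linarith)
      push_cast
      linarith
  obtain ⟨N, hN⟩ := exists_nat_gt (2 * B / ((1 - l) * (ε / 2)))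
  filter_upwards [eventually_gt_atTop N] with n hn
  have hn0 : (0 : ℝ) < n := by exact_mod_cast (Nat.zero_le N).trans_lt hn
  rw [le_div_iff₀ hn0]
  have hd : 0 < (1 - l) * (ε / 2) := mul_pos (by linarith) (by linarith)
  have hN' : (N : ℝ) < n := by exact_mod_cast hn
  have h5 : 2 * B < n * ((1 - l) * (ε / 2)) := (div_lt_iff₀ hd).1 (hN.trans hN')
  have h6 := abs_le.1 (hB (ρ 0))
  have h7 := abs_le.1 (hB (ρ n))
  have h8 : -(2 * B) ≤ l * (u l (ρ 0) - u l (ρ n)) := by nlinarith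
  have h9 := hsum n
  refine le_of_mul_le_mul_left (a := 1 - l) ?_ (by linarith)
  nlinarith

theorem aux_bdd {S : Type} (w : S → S → ℝ) (W : ℝ)
    (hW : ∀ s t, |w s t| ≤ W) (ρ : ℕ → S) (n : ℕ) :
    |(∑ i ∈ Finset.range n, w (ρ i) (ρ (i + 1))) / (n : ℝ)| ≤ W := by
  have hW0 : 0 ≤ W := (abs_nonneg _).trans (hW (ρ 0) (ρ 0))
  rw [abs_div, Nat.abs_cast]
  refine div_le_of_le_mul₀ (by positivity) hW0 ?_
  refine (Finset.abs_sum_le_sum_abs _ _).trans ?_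
  refine (Finset.sum_le_sum fun i _ => hW (ρ i) (ρ (i + 1))).trans ?_
  simp [mul_comm]

theorem aux_ultra {S : Type} [Finite S] (U : Ultrafilter ℝ) (P : ℝ → S → Prop)
    (h : ∀ᶠ l in (U : Filter ℝ), ∃ t, P l t) : ∃ t, ∀ᶠ l in (U : Filter ℝ), P l t := by
  by_contra hc
  push Not at hc
  have h2 : ∀ᶠ l in (U : Filter ℝ), ∀ t, ¬ P l t :=
    eventually_all.2 fun t => hc t
  obtain ⟨l, ⟨t, ht⟩, h'⟩ := (h.and h2).exists
  exact h' t ht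

theorem aux_main {S : Type} [Finite S] (H : GameGraph S) (ω : S → S → ℤ) :
    ∃ (A : ℝ) (π1 : Strat H H.S1) (π2 : Strat H H.S2), π1.Memoryless ∧ π2.Memoryless ∧
      (∀ π2', A ≤ limAvg ω (H.outcome π1 π2')) ∧ (∀ π1', limAvg ω (H.outcome π1' π2) ≤ A) := by
  have := Fintype.ofFinite S
  let w : S → S → ℝ := fun s t => ω s t
  obtain ⟨W, hW⟩ : ∃ W, ∀ s t, |w s t| ≤ W := by
    obtain ⟨B, hB⟩ := (Set.finite_range (fun p : S × S => |w p.1 p.2|)).bddAbove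
    exact ⟨B, fun s t => hB ⟨(s, t), rfl⟩⟩
  let U : Ultrafilter ℝ := Ultrafilter.of (𝓝[<] (1 : ℝ))
  have hU : (U : Filter ℝ) ≤ 𝓝[<] 1 := Ultrafilter.of_le _
  have hid : Tendsto (fun l : ℝ => l) U (𝓝 1) := (hU.trans nhdsWithin_le_nhds)
  have hlt : ∀ᶠ l in (U : Filter ℝ), l < 1 := hU self_mem_nhdsWithin
  have hpos : ∀ᶠ l in (U : Filter ℝ), 0 < l := hid.eventually (lt_mem_nhds one_pos)
  have hex : ∀ l : ℝ, ∃ u : S → ℝ, 0 < l → l < 1 → (∀ s, |u s| ≤ W) ∧ ∀ s, ∃ t, H.E s t ∧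
      u s = (1 - l) * w s t + l * u t ∧
      (s ∈ H.S1 → ∀ t', H.E s t' → (1 - l) * w s t' + l * u t' ≤ u s) ∧
      (s ∉ H.S1 → ∀ t', H.E s t' → u s ≤ (1 - l) * w s t' + l * u t') := by
    intro l
    by_cases h : 0 < l ∧ l < 1
    · obtain ⟨u, hu⟩ := aux_disc H w W hW l h.1 h.2
      exact ⟨u, fun _ _ => hu⟩
    · exact ⟨0, fun a b => absurd ⟨a, b⟩ h⟩
  choose u hu using hex
  have hu' := (hpos.and hlt).mono fun l h => hu l h.1 h.2
  have hlim : ∀ s, ∃ x, Tendsto (fun l => u l s) U (𝓝 x) := by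
    intro s
    obtain ⟨x, -, hx⟩ := (isCompact_Icc (a := -W) (b := W)).ultrafilter_le_nhds
      (U.map (fun l => u l s)) (le_principal_iff.2 (hu'.mono fun l h => abs_le.1 (h.1 s)))
    exact ⟨x, hx⟩
  choose v hv using hlim
  have hst : ∀ s, ∃ t, ∀ᶠ l in (U : Filter ℝ), H.E s t ∧ u l s = (1 - l) * w s t + l * u l t :=
    fun s => aux_ultra U _ (hu'.mono fun l h => by
      obtain ⟨t, h1, h2, -⟩ := h.2 s
      exact ⟨t, h1, h2⟩)
  choose σ hσ using hst
  have hσE : ∀ s, H.E s (σ s) := fun s => (hσ s).exists.choose_spec.1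
  have hσ' : ∀ᶠ l in (U : Filter ℝ), ∀ s, u l s = (1 - l) * w s (σ s) + l * u l (σ s) :=
    eventually_all.2 fun s => (hσ s).mono fun l h => h.2
  let π1 : Strat H H.S1 := ⟨fun _ s => σ s, fun _ s _ => hσE s⟩
  let π2 : Strat H H.S2 := ⟨fun _ s => σ s, fun _ s _ => hσE s⟩
  refine ⟨v H.init, π1, π2, fun _ _ _ => rfl, fun _ _ _ => rfl, fun π2' => ?_, fun π1' => ?_⟩
  · set ρ := H.outcome π1 π2' with hρ
    have hb := fun n => abs_le.1 (aux_bdd w W hW ρ n)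
    have hcore := aux_core w U hU u v hv ρ (by
      filter_upwards [hσ', hu'] with l h1 h2 n
      by_cases hn : ρ n ∈ H.S1
      · have : ρ (n + 1) = σ (ρ n) := if_pos hn
        rw [this]
        exact (h1 _).le
      · have h : ρ (n + 1) = π2'.f (H.hist π1 π2' n).1 (ρ n) := if_neg hn
        obtain ⟨t, -, -, -, h3⟩ := h2.2 (ρ n)
        refine h3 hn _ ?_
        rw [h]
        exact π2'.valid _ _ (by by_contra h'; exact hn ((H.partition _).2 h')))
    refine le_of_forall_pos_sub_le fun ε hε => ?_
    refine le_liminf_of_le ?_ (hcore ε hε)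
    exact (isBoundedUnder_of ⟨W, fun n => (hb n).2⟩).isCoboundedUnder_ge
  · set ρ := H.outcome π1' π2 with hρ
    have hb := fun n => abs_le.1 (aux_bdd w W hW ρ n)
    have hcore := aux_core (fun s t => - w s t) U hU (fun l s => - u l s) (fun s => - v s)
      (fun s => (hv s).neg) ρ (by
      filter_upwards [hσ', hu'] with l h1 h2 n
      by_cases hn : ρ n ∈ H.S1
      · have h : ρ (n + 1) = π1'.f (H.hist π1' π2 n).1 (ρ n) := if_pos hn
        obtain ⟨t, -, -, h3, -⟩ := h2.2 (ρ n)
        have := h3 hn (ρ (n + 1)) (by rw [h]; exact π1'.valid _ _ hn)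
        linarith
      · have : ρ (n + 1) = σ (ρ n) := if_neg hn
        rw [this]
        have := h1 (ρ n)
        linarith)
    refine le_of_forall_pos_le_add fun ε hε => ?_
    have hbb : IsBoundedUnder (· ≥ ·) atTop
      (fun n : ℕ => (∑ i ∈ Finset.range n, w (ρ i) (ρ (i + 1))) / (n : ℝ)) :=
      isBoundedUnder_of ⟨-W, fun n => (hb n).1⟩
    refine (liminf_le_limsup (isBoundedUnder_of ⟨W, fun n => (hb n).2⟩) hbb).trans ?_
    refine limsup_le_of_le hbb.isCoboundedUnder_le ?_
    filter_upwards [hcore ε hε] with n hn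
    rw [Finset.sum_neg_distrib, neg_div] at hn
    have : ρ 0 = H.init := rfl
    rw [this] at hn
    simp only [w] at hn
    linarith

end Aux

/-- Memoryless determinacy of limit-average games: for every finite game
graph `H` and integer weight function `ω`, the lower and upper values of the limit-average
game coincide, and both players have memoryless optimal strategies achieving this value. -/
theorem limAvg_determinacy_memoryless {S : Type} [Finite S]
    (H : GameGraph S) (ω : S → S → ℤ) :
    H.supInf (limAvg ω) = H.infSup (limAvg ω) ∧
    (∃ π1 : Strat H H.S1, π1.Memoryless ∧
      (⨅ π2 : Strat H H.S2, ((limAvg ω (H.outcome π1 π2) : ℝ) : EReal)) =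
        H.supInf (limAvg ω)) ∧
    (∃ π2 : Strat H H.S2, π2.Memoryless ∧
      (⨆ π1 : Strat H H.S1, ((limAvg ω (H.outcome π1 π2) : ℝ) : EReal)) =
        H.supInf (limAvg ω)) := by
  obtain ⟨A, π1, π2, hm1, hm2, h1, h2⟩ := aux_main H ω
  have a1 : (A : EReal) ≤ ⨅ π2 : Strat H H.S2, ((limAvg ω (H.outcome π1 π2) : ℝ) : EReal) :=
    le_iInf fun π => EReal.coe_le_coe_iff.2 (h1 π)
  have a2 : (⨆ π1 : Strat H H.S1, ((limAvg ω (H.outcome π1 π2) : ℝ) : EReal)) ≤ A :=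
    iSup_le fun π => EReal.coe_le_coe_iff.2 (h2 π)
  have a3 : (⨅ π2 : Strat H H.S2, ((limAvg ω (H.outcome π1 π2) : ℝ) : EReal)) ≤
      H.supInf (limAvg ω) :=
    le_iSup (fun π1 : Strat H H.S1 =>
      ⨅ π2 : Strat H H.S2, ((limAvg ω (H.outcome π1 π2) : ℝ) : EReal)) π1
  have a4 : H.infSup (limAvg ω) ≤
      (⨆ π1 : Strat H H.S1, ((limAvg ω (H.outcome π1 π2) : ℝ) : EReal)) :=
    iInf_le (fun π2 : Strat H H.S2 =>
      ⨆ π1 : Strat H H.S1, ((limAvg ω (H.outcome π1 π2) : ℝ) : EReal)) π2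
  have a5 : H.supInf (limAvg ω) ≤ H.infSup (limAvg ω) := iSup_iInf_le_iInf_iSup _
  have e1 : H.supInf (limAvg ω) = A := le_antisymm (a5.trans (a4.trans a2)) (a1.trans a3)
  have e2 : H.infSup (limAvg ω) = A := le_antisymm (a4.trans a2) (e1.symm.le.trans a5)
  refine ⟨e1.trans e2.symm, ⟨π1, hm1, le_antisymm a3 (e1.le.trans a1)⟩, ⟨π2, hm2, ?_⟩⟩
  exact le_antisymm (a2.trans e1.symm.le) (a5.trans a4)
end

section
/- For every game graph H = (S, S1, S2, E, sι), every weight function ω : E → ℤ, and every discount factor 0 < λ < 1, the discounted-sum game is determined: sup_{π1∈Π1} inf_{π2∈Π2} Disc_λ(Out_H(π1,π2)) = inf_{π2∈Π2} sup_{π1∈Π1} Disc_λ(Out_H(π1,π2)); moreover there exist memoryless optimal strategies for both players, i.e., a memoryless Player-1 strategy π1* with inf_{π2∈Π2} Disc_λ(Out_H(π1*,π2)) equal to this common value, and a memoryless Player-2 strategy π2* with sup_{π1∈Π1} Disc_λ(Out_H(π1,π2*)) equal to this common value. -/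
open scoped Classical

theorem aux_iSup_diff {ι : Type} [Finite ι] [Nonempty ι] (f g : ι → ℝ) (c : ℝ)
    (h : ∀ i, |f i - g i| ≤ c) : |(⨆ i, f i) - (⨆ i, g i)| ≤ c := by
  have hf : BddAbove (Set.range f) := (Set.finite_range f).bddAbove
  have hg : BddAbove (Set.range g) := (Set.finite_range g).bddAbove
  have h1 : (⨆ i, f i) ≤ (⨆ i, g i) + c := ciSup_le fun i => by
    have := le_ciSup hg i
    have := (abs_le.1 (h i)).2
    linarith
  have h2 : (⨆ i, g i) ≤ (⨆ i, f i) + c := ciSup_le fun i => by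
    have := le_ciSup hf i
    have := (abs_le.1 (h i)).1
    linarith
  rw [abs_le]; constructor <;> linarith

theorem aux_iInf_diff {ι : Type} [Finite ι] [Nonempty ι] (f g : ι → ℝ) (c : ℝ)
    (h : ∀ i, |f i - g i| ≤ c) : |(⨅ i, f i) - (⨅ i, g i)| ≤ c := by
  have hf : BddBelow (Set.range f) := (Set.finite_range f).bddBelow
  have hg : BddBelow (Set.range g) := (Set.finite_range g).bddBelow
  have h1 : (⨅ i, f i) - c ≤ (⨅ i, g i) := le_ciInf fun i => by
    have := ciInf_le hf i
    have := (abs_le.1 (h i)).2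
    linarith
  have h2 : (⨅ i, g i) - c ≤ (⨅ i, f i) := le_ciInf fun i => by
    have := ciInf_le hg i
    have := (abs_le.1 (h i)).1
    linarith
  rw [abs_le]; constructor <;> linarith

theorem aux_bellman {S : Type} [Finite S]
    (H : GameGraph S) (ω : S → S → ℤ) (lam : ℝ) (hlam0 : 0 < lam) (hlam1 : lam < 1) :
    ∃ v : S → ℝ,
      (∀ s ∈ H.S1, ∀ t, H.E s t → (ω s t : ℝ) + lam * v t ≤ v s) ∧
      (∀ s ∈ H.S2, ∀ t, H.E s t → v s ≤ (ω s t : ℝ) + lam * v t) ∧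
      (∀ s, ∃ t, H.E s t ∧ v s = (ω s t : ℝ) + lam * v t) := by
  have := Fintype.ofFinite S
  have hne : ∀ s, Nonempty {t // H.E s t} := fun s => by
    obtain ⟨t, ht⟩ := H.serial s
    exact ⟨⟨t, ht⟩⟩
  let T : (S → ℝ) → (S → ℝ) := fun v s =>
    if s ∈ H.S1 then ⨆ t : {t // H.E s t}, ((ω s t : ℝ) + lam * v t)
    else ⨅ t : {t // H.E s t}, ((ω s t : ℝ) + lam * v t)
  have hT : ContractingWith ⟨lam, hlam0.le⟩ T := by
    refine ⟨by exact_mod_cast hlam1, LipschitzWith.of_dist_le_mul fun v w => ?_⟩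
    change dist (T v) (T w) ≤ lam * dist v w
    rw [dist_pi_le_iff (mul_nonneg hlam0.le dist_nonneg)]
    intro s
    have key : ∀ t : {t // H.E s t},
        |((ω s t : ℝ) + lam * v t) - ((ω s t : ℝ) + lam * w t)| ≤ lam * dist v w := by
      intro t
      have h1 : ((ω s t : ℝ) + lam * v t) - ((ω s t : ℝ) + lam * w t)
          = lam * (v t - w t) := by ring
      rw [h1, abs_mul, abs_of_pos hlam0]
      exact mul_le_mul_of_nonneg_left (dist_le_pi_dist v w t) hlam0.le
    rw [Real.dist_eq]
    by_cases hs : s ∈ H.S1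
    · simp only [T, hs, if_true]
      exact aux_iSup_diff _ _ _ key
    · simp only [T, hs, if_false]
      exact aux_iInf_diff _ _ _ key
  let v := ContractingWith.fixedPoint T hT
  have hv : T v = v := hT.fixedPoint_isFixedPt
  refine ⟨v, fun s hs t ht => ?_, fun s hs t ht => ?_, fun s => ?_⟩
  · have h := congrFun hv s
    simp only [T, hs, if_true] at h
    rw [← h]
    exact le_ciSup (f := fun t : {t // H.E s t} => ((ω s t : ℝ) + lam * v t))
      (Set.finite_range _).bddAbove ⟨t, ht⟩
  · have h := congrFun hv s
    have hs' : s ∉ H.S1 := fun h => (H.partition s).1 h hs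
    simp only [T, hs', if_false] at h
    rw [← h]
    exact ciInf_le (f := fun t : {t // H.E s t} => ((ω s t : ℝ) + lam * v t))
      (Set.finite_range _).bddBelow ⟨t, ht⟩
  · have h := congrFun hv s
    by_cases hs : s ∈ H.S1
    · simp only [T, hs, if_true] at h
      obtain ⟨t, ht⟩ := exists_eq_ciSup_of_finite
        (f := fun t : {t // H.E s t} => ((ω s t : ℝ) + lam * v t))
      exact ⟨t, t.2, by rw [← h]; exact ht.symm⟩
    · simp only [T, hs, if_false] at h
      obtain ⟨t, ht⟩ := exists_eq_ciInf_of_finite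
        (f := fun t : {t // H.E s t} => ((ω s t : ℝ) + lam * v t))
      exact ⟨t, t.2, by rw [← h]; exact ht.symm⟩

theorem aux_lim {S : Type} [Finite S] (ω : S → S → ℤ) (lam : ℝ) (hlam0 : 0 < lam)
    (hlam1 : lam < 1) (v : S → ℝ) (ρ : ℕ → S) :
    Filter.Tendsto (fun n => (∑ i ∈ Finset.range n, lam ^ i * (ω (ρ i) (ρ (i + 1)) : ℝ))
      + lam ^ n * v (ρ n)) Filter.atTop (nhds (disc lam ω ρ)) := by
  have hs : Summable (fun i : ℕ => lam ^ i * (ω (ρ i) (ρ (i + 1)) : ℝ)) := by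
    obtain ⟨C, hC⟩ := (Set.finite_range (fun p : S × S => |(ω p.1 p.2 : ℝ)|)).bddAbove
    refine Summable.of_norm_bounded
      ((summable_geometric_of_lt_one hlam0.le hlam1).mul_right C) fun i => ?_
    rw [Real.norm_eq_abs, abs_mul, abs_of_pos (pow_pos hlam0 i)]
    exact mul_le_mul_of_nonneg_left (hC ⟨(ρ i, ρ (i + 1)), rfl⟩) (pow_pos hlam0 i).le
  have h0 : Filter.Tendsto (fun n => lam ^ n * v (ρ n)) Filter.atTop (nhds 0) := by
    obtain ⟨C, hC⟩ := (Set.finite_range (fun p : S => |v p|)).bddAbove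
    refine squeeze_zero_norm (a := fun n => lam ^ n * C) (fun n => ?_) ?_
    · rw [Real.norm_eq_abs, abs_mul, abs_of_pos (pow_pos hlam0 n)]
      exact mul_le_mul_of_nonneg_left (hC ⟨ρ n, rfl⟩) (pow_pos hlam0 n).le
    · simpa using (tendsto_pow_atTop_nhds_zero_of_lt_one hlam0.le hlam1).mul_const C
  simpa [disc] using hs.hasSum.tendsto_sum_nat.add h0

theorem aux_lower {S : Type} [Finite S] (ω : S → S → ℤ) (lam : ℝ) (hlam0 : 0 < lam)
    (hlam1 : lam < 1) (v : S → ℝ) (ρ : ℕ → S)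
    (h : ∀ n, v (ρ n) ≤ (ω (ρ n) (ρ (n + 1)) : ℝ) + lam * v (ρ (n + 1))) :
    v (ρ 0) ≤ disc lam ω ρ := by
  refine ge_of_tendsto' (aux_lim ω lam hlam0 hlam1 v ρ) fun n => ?_
  induction n with
  | zero => simp
  | succ n ih =>
    rw [Finset.sum_range_succ, pow_succ]
    have := mul_le_mul_of_nonneg_left (h n) (pow_pos hlam0 n).le
    linarith

theorem aux_upper {S : Type} [Finite S] (ω : S → S → ℤ) (lam : ℝ) (hlam0 : 0 < lam)
    (hlam1 : lam < 1) (v : S → ℝ) (ρ : ℕ → S)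
    (h : ∀ n, (ω (ρ n) (ρ (n + 1)) : ℝ) + lam * v (ρ (n + 1)) ≤ v (ρ n)) :
    disc lam ω ρ ≤ v (ρ 0) := by
  refine le_of_tendsto' (aux_lim ω lam hlam0 hlam1 v ρ) fun n => ?_
  induction n with
  | zero => simp
  | succ n ih =>
    rw [Finset.sum_range_succ, pow_succ]
    have := mul_le_mul_of_nonneg_left (h n) (pow_pos hlam0 n).le
    linarith

/-- Memoryless determinacy of discounted-sum games: for every finite game
graph `H`, integer weight function `ω` and discount factor `0 < λ < 1`, the lower and upper
values of the discounted-sum game coincide, and both players have memoryless optimal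
strategies achieving this value. -/
theorem disc_determinacy_memoryless {S : Type} [Finite S]
    (H : GameGraph S) (ω : S → S → ℤ) (lam : ℝ) (hlam0 : 0 < lam) (hlam1 : lam < 1) :
    H.supInf (disc lam ω) = H.infSup (disc lam ω) ∧
    (∃ π1 : Strat H H.S1, π1.Memoryless ∧
      (⨅ π2 : Strat H H.S2, ((disc lam ω (H.outcome π1 π2) : ℝ) : EReal)) =
        H.supInf (disc lam ω)) ∧
    (∃ π2 : Strat H H.S2, π2.Memoryless ∧
      (⨆ π1 : Strat H H.S1, ((disc lam ω (H.outcome π1 π2) : ℝ) : EReal)) =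
        H.supInf (disc lam ω)) := by
  obtain ⟨v, hv1, hv2, hv3⟩ := aux_bellman H ω lam hlam0 hlam1
  choose c hcE hc using hv3
  let p1 : Strat H H.S1 := ⟨fun _ s => c s, fun _ s _ => hcE s⟩
  let p2 : Strat H H.S2 := ⟨fun _ s => c s, fun _ s _ => hcE s⟩
  have hstep : ∀ (π1 : Strat H H.S1) (π2 : Strat H H.S2) n, H.outcome π1 π2 (n + 1) =
      if H.outcome π1 π2 n ∈ H.S1 then π1.f (H.hist π1 π2 n).1 (H.outcome π1 π2 n)
      else π2.f (H.hist π1 π2 n).1 (H.outcome π1 π2 n) := fun _ _ _ => rfl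
  have hS2 : ∀ s, s ∉ H.S1 → s ∈ H.S2 := fun s hs => by
    by_contra h
    exact hs ((H.partition s).2 h)
  have hlow : ∀ π2, v H.init ≤ disc lam ω (H.outcome p1 π2) := fun π2 => by
    refine aux_lower ω lam hlam0 hlam1 v (H.outcome p1 π2) fun n => ?_
    rw [hstep]
    split_ifs with h
    · exact (hc _).le
    · exact hv2 _ (hS2 _ h) _ (π2.valid _ _ (hS2 _ h))
  have hup : ∀ π1, disc lam ω (H.outcome π1 p2) ≤ v H.init := fun π1 => by
    refine aux_upper ω lam hlam0 hlam1 v (H.outcome π1 p2) fun n => ?_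
    rw [hstep]
    split_ifs with h
    · exact hv1 _ h _ (π1.valid _ _ h)
    · exact (hc _).ge
  have h1 : ((v H.init : ℝ) : EReal) ≤
      ⨅ π2 : Strat H H.S2, ((disc lam ω (H.outcome p1 π2) : ℝ) : EReal) :=
    le_iInf fun π2 => EReal.coe_le_coe_iff.2 (hlow π2)
  have h2 : (⨅ π2 : Strat H H.S2, ((disc lam ω (H.outcome p1 π2) : ℝ) : EReal)) ≤
      H.supInf (disc lam ω) :=
    le_iSup (fun π1 : Strat H H.S1 =>
      ⨅ π2 : Strat H H.S2, ((disc lam ω (H.outcome π1 π2) : ℝ) : EReal)) p1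
  have h3 : H.supInf (disc lam ω) ≤ H.infSup (disc lam ω) := iSup_iInf_le_iInf_iSup _
  have h4 : H.infSup (disc lam ω) ≤
      ⨆ π1 : Strat H H.S1, ((disc lam ω (H.outcome π1 p2) : ℝ) : EReal) :=
    iInf_le (fun π2 : Strat H H.S2 =>
      ⨆ π1 : Strat H H.S1, ((disc lam ω (H.outcome π1 π2) : ℝ) : EReal)) p2
  have h5 : (⨆ π1 : Strat H H.S1, ((disc lam ω (H.outcome π1 p2) : ℝ) : EReal)) ≤
      ((v H.init : ℝ) : EReal) :=
    iSup_le fun π1 => EReal.coe_le_coe_iff.2 (hup π1)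
  refine ⟨le_antisymm h3 (h4.trans (h5.trans (h1.trans h2))),
    ⟨p1, fun _ _ _ => rfl, le_antisymm h2 (h3.trans (h4.trans (h5.trans h1)))⟩,
    ⟨p2, fun _ _ _ => rfl, le_antisymm (h5.trans (h1.trans h2)) (h3.trans h4)⟩⟩
end

section
/- Let F and F' be BIAs with AI_F ⊆ AI_F' and AO_F ⊇ AO_F'. If F ⪰ F' (F' refines F), then Player 2 has a winning strategy in the alternating simulation game H_{F,F'}, i.e., a Player-2 strategy π2 such that no play conformant to π2 ever visits the state s_err. -/
open scoped Classical

/-- If `F' refines F` (`F ⪰ F'`), then Player 2 has a winning strategy in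
the alternating simulation game `H_{F,F'}`: a strategy such that no play conformant to it
ever visits the error state `s_err`. -/
theorem refines_imp_player2_winning {Q Q' Act : Type} [Finite Q] [Finite Q'] [Finite Act]
    (F : IA Q Act) (F' : IA Q' Act) (hF : F.IsBIA) (hF' : F'.IsBIA)
    (hAI : F.AI ⊆ F'.AI) (hAO : F'.AO ⊆ F.AO)
    (href : F.Refines F') :
    ∃ π2 : Strat (simGame F F') (simGame F F').S2,
      ∀ ρ : ℕ → GS Q Q' Act, (simGame F F').IsPlay ρ → Conformant π2 ρ →
        ∀ n, ρ n ≠ GS.err := by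
  obtain ⟨-, -, R, hR, h0⟩ := href
  let G0 : GS Q Q' Act → Prop := fun s => ∃ q q', s = GS.st q none q' ∧ R q q'
  have hch : ∀ s : GS Q Q' Act, ∃ y, (simGame F F').E s y ∧
      ((∃ z, (simGame F F').E s z ∧ G0 z) → G0 y) := by
    intro s
    by_cases h : ∃ z, (simGame F F').E s z ∧ G0 z
    · obtain ⟨z, hz, hg⟩ := h
      exact ⟨z, hz, fun _ => hg⟩
    · obtain ⟨z, hz⟩ := (simGame F F').serial s
      exact ⟨z, hz, fun h' => absurd h' h⟩
  choose f hf1 hf2 using hch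
  refine ⟨⟨fun _ s => f s, fun _ s _ => hf1 s⟩, ?_⟩
  intro ρ hρ hc
  have key : ∀ n, G0 (ρ n) ∨ ((ρ n).isP2 ∧ ∃ z, (simGame F F').E (ρ n) z ∧ G0 z) := by
    intro n
    induction n with
    | zero => exact Or.inl ⟨_, _, hρ.1, h0⟩
    | succ n ih =>
      rcases ih with ⟨q, q', hq, hr⟩ | ⟨h2, hz⟩
      · have he := hρ.2 n
        rw [hq] at he
        rcases he with he | ⟨hp, -, -⟩ | ⟨-, -, he⟩
        · generalize ρ (n + 1) = y at he
          rcases y with _ | ⟨t, _ | a, t'⟩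
          · exact he.elim
          · exact he.elim
          · right
            refine ⟨trivial, ?_⟩
            rcases he with ⟨ha, hd, rfl⟩ | ⟨ha, hd, rfl⟩
            · obtain ⟨r', hd', hr'⟩ := (hR _ _ hr).1 a ha t hd
              exact ⟨GS.st t none r', Or.inl (Or.inl ⟨ha, hd', rfl⟩), _, _, rfl, hr'⟩
            · obtain ⟨r, hd', hr'⟩ := (hR _ _ hr).2 a ha t' hd
              exact ⟨GS.st r none t', Or.inl (Or.inr ⟨ha, hd', rfl⟩), _, _, rfl, hr'⟩
        · exact hp.elim
        · exact Or.inl ⟨q, q', he, hr⟩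
      · left
        rw [hc n h2]
        exact hf2 _ hz
  intro n hn
  rcases key n with ⟨q, q', hq, -⟩ | ⟨h2, -⟩
  · rw [hn] at hq
    cases hq
  · rw [hn] at h2
    exact h2
end

section
/- Let F and F' be BIAs with AI_F ⊆ AI_F' and AO_F ⊇ AO_F'. If Player 2 has a winning strategy in the alternating simulation game H_{F,F'} (a Player-2 strategy π2 such that no play conformant to π2 ever visits s_err), then F ⪰ F' (F' refines F). -/
open scoped Classical

theorem extend_play {S : Type} {H : GameGraph S} (π : Strat H H.S2) (ρ : ℕ → S)
    (hp : H.IsPlay ρ) (hc : Conformant π ρ) (n : ℕ) (t : S) (hn : ρ n ∉ H.S2)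
    (ht : H.E (ρ n) t) :
    ∃ ρ' : ℕ → S, H.IsPlay ρ' ∧ Conformant π ρ' ∧ ρ' (n + 1) = t := by
  choose nx hnx using H.serial
  let h : ℕ → List S × S := fun k => Nat.rec ([], H.init) (fun k p =>
    (p.1 ++ [p.2], if k < n then ρ (k + 1) else if k = n then t else
      if p.2 ∈ H.S2 then π.f p.1 p.2 else nx p.2)) k
  have h0 : h 0 = ([], H.init) := rfl
  have hs : ∀ k, h (k + 1) = ((h k).1 ++ [(h k).2], if k < n then ρ (k + 1) else
      if k = n then t else
      if (h k).2 ∈ H.S2 then π.f (h k).1 (h k).2 else nx (h k).2) := fun k => rfl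
  clear_value h
  have hl : ∀ k, (h k).1 = List.ofFn (fun i : Fin k => (h i).2) := by
    intro k
    induction k with
    | zero => simp [h0]
    | succ k ih => 
      rw [hs, List.ofFn_succ_last]
      simp [ih]
  have hr : ∀ k, k ≤ n → (h k).2 = ρ k := by
    intro k hk
    cases k with
    | zero => rw [h0, hp.1]
    | succ k => rw [hs]; simp [show k < n by omega]
  refine ⟨fun k => (h k).2, ⟨by simp [h0], ?_⟩, ?_, ?_⟩
  · intro k
    rcases lt_trichotomy k n with hk | hk | hk
    · have := hp.2 k
      simp only [hr k hk.le, hr (k + 1) hk]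
      exact this
    · subst hk
      simp only [hr k le_rfl, hs]
      simpa using ht
    · simp only [hs k, show ¬ k < n by omega, show ¬ k = n by omega, if_false]
      split_ifs with h2
      · exact π.valid _ _ h2
      · exact hnx _
  · intro k hk
    rcases lt_trichotomy k n with hkn | hkn | hkn
    · have e : (fun i : Fin k => (h i).2) = fun i : Fin k => ρ i := by
        funext i
        exact hr i (by omega)
      simp only [hr k hkn.le] at hk
      simp only [e, hr k hkn.le, hr (k + 1) hkn]
      exact hc k hk
    · subst hkn
      simp only [hr k le_rfl] at hk
      exact absurd hk hn
    · simp only at hk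
      simp only [← hl]
      simp only [hs k, show ¬ k < n by omega, show ¬ k = n by omega, if_false, if_pos hk]
  · simp [hs]

/-- If Player 2 has a winning strategy in the alternating simulation game
`H_{F,F'}` (no play conformant to it visits `s_err`), then `F' refines F` (`F ⪰ F'`). -/
theorem player2_winning_imp_refines {Q Q' Act : Type} [Finite Q] [Finite Q'] [Finite Act]
    (F : IA Q Act) (F' : IA Q' Act) (hF : F.IsBIA) (hF' : F'.IsBIA)
    (hAI : F.AI ⊆ F'.AI) (hAO : F'.AO ⊆ F.AO)
    (hwin : ∃ π2 : Strat (simGame F F') (simGame F F').S2,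
      ∀ ρ : ℕ → GS Q Q' Act, (simGame F F').IsPlay ρ → Conformant π2 ρ →
        ∀ n, ρ n ≠ GS.err) :
    F.Refines F' := by
  obtain ⟨π, hπ⟩ := hwin
  refine ⟨hAI, hAO, fun q q' => ∃ ρ n, (simGame F F').IsPlay ρ ∧ Conformant π ρ ∧
    ρ n = GS.st q none q', ?_, ?_⟩
  · rintro q q' ⟨ρ, n, hp, hc, hn⟩
    have key : ∀ t a t', rawEdge F F' (GS.st q none q') (GS.st t (some a) t') →
        ∃ u v, rawEdge F F' (GS.st t (some a) t') (GS.st u none v) ∧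
          ∃ ρ n, (simGame F F').IsPlay ρ ∧ Conformant π ρ ∧ ρ n = GS.st u none v := by
      intro t a t' he
      obtain ⟨ρ', hp', hc', e⟩ := extend_play π ρ hp hc n (GS.st t (some a) t')
        (by rw [hn]; exact fun h => h) (by rw [hn]; exact Or.inl he)
      have h1 := hp'.2 (n + 1)
      have h2 := hπ ρ' hp' hc' (n + 1 + 1)
      rw [e] at h1
      rcases h1 with h1 | ⟨_, _, h1⟩ | ⟨h1, _⟩
      · generalize hx : ρ' (n + 1 + 1) = x at h1 h2
        match x, h1 with
        | .st u none v, h1 => exact ⟨u, v, h1, ρ', _, hp', hc', hx⟩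
      · exact absurd h1 h2
      · exact absurd trivial h1
    have hd : ∀ a, a ∈ F.AI → a ∈ F'.AO → False := fun a h1 h2 =>
      Set.disjoint_left.1 hF.disj h1 (hAO h2)
    constructor
    · intro a ha r hr
      obtain ⟨u, v, he, hR⟩ := key r a q' (Or.inl ⟨ha, hr, rfl⟩)
      rcases he with ⟨_, hv, rfl⟩ | ⟨h, _⟩
      · exact ⟨v, hv, hR⟩
      · exact (hd a ha h).elim
    · intro a ha r hr
      obtain ⟨u, v, he, hR⟩ := key q a r (Or.inr ⟨ha, hr, rfl⟩)
      rcases he with ⟨h, _⟩ | ⟨_, hv, rfl⟩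
      · exact (hd a h ha).elim
      · exact ⟨u, hv, hR⟩
  · choose nx hnx using (simGame F F').serial
    let h : ℕ → List (GS Q Q' Act) × GS Q Q' Act := fun k =>
      Nat.rec ([], (simGame F F').init) (fun _ p => (p.1 ++ [p.2],
        if p.2 ∈ (simGame F F').S2 then π.f p.1 p.2 else nx p.2)) k
    have h0 : h 0 = ([], (simGame F F').init) := rfl
    have hs : ∀ k, h (k + 1) = ((h k).1 ++ [(h k).2],
        if (h k).2 ∈ (simGame F F').S2 then π.f (h k).1 (h k).2 else nx (h k).2) :=
      fun k => rfl
    clear_value h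
    have hl : ∀ k, (h k).1 = List.ofFn (fun i : Fin k => (h i).2) := by
      intro k
      induction k with
      | zero => simp [h0]
      | succ k ih =>
        rw [hs, List.ofFn_succ_last]
        simp [ih]
    refine ⟨fun k => (h k).2, 0, ⟨by simp [h0], ?_⟩, ?_, by simp only [h0]; rfl⟩
    · intro k
      simp only [hs k]
      split_ifs with h2
      · exact π.valid _ _ h2
      · exact hnx _
    · intro k hk
      simp only at hk
      simp only [← hl]
      simp only [hs k, if_pos hk]
end

section
/- The interface simulation distance for the limit-average objective satisfies the triangle inequality: for all BIAs F1, F2, F3 over the same input alphabet AI and output alphabet AO, every output error model MO, and every input error model MI, d^{LimAvg}(F1⊗MO, F3⊗MI) ≤ d^{LimAvg}(F1⊗MO, F2⊗MI) + d^{LimAvg}(F2⊗MO, F3⊗MI). -/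
open scoped Classical

/-- Discounted fixed point. -/
theorem aux_fixpoint {S : Type} [Finite S] (H : GameGraph S) (w : S → S → ℤ) (C : ℝ)
    (hC : 0 ≤ C) (hw0 : ∀ s t, 0 ≤ w s t) (hwC : ∀ s t, (w s t : ℝ) ≤ C)
    (l : ℝ) (hl0 : 0 ≤ l) (hl1 : l ≤ 1) :
    ∃ u : S → Set.Icc (0:ℝ) C,
      (∀ s, ∃ t, H.E s t ∧ (u s : ℝ) = l * w s t + (1 - l) * u t) ∧
      (∀ s ∈ H.S1, ∀ t, H.E s t → l * w s t + (1 - l) * u t ≤ (u s : ℝ)) ∧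
      (∀ s ∈ H.S2, ∀ t, H.E s t → (u s : ℝ) ≤ l * w s t + (1 - l) * u t) := by
  have : Fact ((0:ℝ) ≤ C) := ⟨hC⟩
  have hw0' : ∀ s t, (0:ℝ) ≤ w s t := fun s t => by exact_mod_cast hw0 s t
  let g : S → S → Set.Icc (0:ℝ) C → Set.Icc (0:ℝ) C := fun s t x =>
    ⟨l * w s t + (1 - l) * x, by
      have := x.2.1; have := x.2.2; have := hw0' s t; have := hwC s t
      have h1 : 0 ≤ 1 - l := by linarith
      constructor
      · positivity
      · nlinarith⟩
  have gmono : ∀ s t, Monotone (g s t) := by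
    intro s t x y hxy
    have h1 : 0 ≤ 1 - l := by linarith
    have : (x : ℝ) ≤ y := hxy
    show l * w s t + (1 - l) * (x:ℝ) ≤ l * w s t + (1 - l) * (y:ℝ)
    nlinarith
  let T : (S → Set.Icc (0:ℝ) C) →o (S → Set.Icc (0:ℝ) C) :=
    { toFun := fun u s => if s ∈ H.S1 then ⨆ t : {t // H.E s t}, g s t (u t)
        else ⨅ t : {t // H.E s t}, g s t (u t)
      monotone' := by
        intro u v huv s
        dsimp only
        split_ifs
        · exact iSup_mono fun t => gmono s t (huv t)
        · exact iInf_mono fun t => gmono s t (huv t) }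
  have hfix : T (OrderHom.lfp T) = OrderHom.lfp T := OrderHom.map_lfp T
  set u := OrderHom.lfp T with hu
  have hs : ∀ s, u s = if s ∈ H.S1 then ⨆ t : {t // H.E s t}, g s t (u t)
        else ⨅ t : {t // H.E s t}, g s t (u t) := fun s => (congrFun hfix s).symm
  refine ⟨u, ?_, ?_, ?_⟩
  · intro s
    have : Nonempty {t // H.E s t} := by
      obtain ⟨t, ht⟩ := H.serial s
      exact ⟨⟨t, ht⟩⟩
    by_cases h : s ∈ H.S1
    · obtain ⟨t, ht⟩ := exists_eq_ciSup_of_finite (f := fun t : {t // H.E s t} => g s t (u t))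
      refine ⟨t, t.2, ?_⟩
      rw [hs s, if_pos h, ← ht]
    · obtain ⟨t, ht⟩ := exists_eq_ciInf_of_finite (f := fun t : {t // H.E s t} => g s t (u t))
      refine ⟨t, t.2, ?_⟩
      rw [hs s, if_neg h, ← ht]
  · intro s h t ht
    have h1 := le_iSup (fun t : {t // H.E s t} => g s t (u t)) ⟨t, ht⟩
    have h2 := hs s
    rw [if_pos h] at h2
    rw [← h2] at h1
    exact h1
  · intro s h t ht
    have h1 := iInf_le (fun t : {t // H.E s t} => g s t (u t)) ⟨t, ht⟩
    have h2 := hs s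
    rw [if_neg (fun h' => (H.partition s).1 h' h)] at h2
    rw [← h2] at h1
    exact h1

/-- Certificates for the value of a mean-payoff game. -/
theorem aux_cert {S : Type} [Finite S] (H : GameGraph S) (w : S → S → ℤ) (C : ℝ)
    (hC : 0 ≤ C) (hw0 : ∀ s t, 0 ≤ w s t) (hwC : ∀ s t, (w s t : ℝ) ≤ C) :
    ∃ u : S → ℝ, (∀ s, 0 ≤ u s) ∧ ∀ ε : ℝ, 0 < ε → ∃ (V : S → ℝ) (D : ℝ),
      (∀ s, 0 ≤ V s ∧ V s ≤ D) ∧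
      (∀ s, ∃ t, H.E s t ∧ u t = u s ∧ w s t + V t ≤ V s + u s + ε ∧
        V s + u s - ε ≤ w s t + V t) ∧
      (∀ s ∈ H.S1, ∀ t, H.E s t → u t ≤ u s ∧ w s t + V t ≤ V s + u s + ε) ∧
      (∀ s ∈ H.S2, ∀ t, H.E s t → u s ≤ u t ∧ V s + u s - ε ≤ w s t + V t) := by
  have hl : ∀ k : ℕ, (0:ℝ) < 1 / ((k:ℝ) + 1) ∧ 1 / ((k:ℝ) + 1) ≤ 1 := by
    intro k
    refine ⟨by positivity, ?_⟩
    rw [div_le_one (by positivity)]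
    have : (0:ℝ) ≤ k := by positivity
    linarith
  choose U hU hU1 hU2 using fun k : ℕ =>
    aux_fixpoint H w C hC hw0 hwC (1 / ((k:ℝ) + 1)) (hl k).1.le (hl k).2
  let F : Ultrafilter ℕ := Filter.hyperfilter ℕ
  have hlim : Filter.Tendsto (fun k : ℕ => 1 / ((k:ℝ) + 1)) F (nhds 0) :=
    tendsto_one_div_add_atTop_nhds_zero_nat.mono_left Nat.hyperfilter_le_atTop
  let L : S → Set.Icc (0:ℝ) C := (F.map U).lim
  have hL : Filter.Tendsto U F (nhds L) := (F.map U).le_nhds_lim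
  let u : S → ℝ := fun s => L s
  have hLs : ∀ s, Filter.Tendsto (fun k => (U k s : ℝ)) F (nhds (u s)) := fun s =>
    (continuous_subtype_val.tendsto _).comp ((tendsto_pi_nhds.1 hL) s)
  have hlimE : ∀ s t, Filter.Tendsto
      (fun k : ℕ => 1 / ((k:ℝ) + 1) * w s t + (1 - 1 / ((k:ℝ) + 1)) * (U k t : ℝ)) F
      (nhds (u t)) := by
    intro s t
    have := (hlim.mul_const (w s t : ℝ)).add (((tendsto_const_nhds (x := (1:ℝ))).sub hlim).mul (hLs t))
    simpa using this
  have hex : ∀ s, ∃ t, ∀ᶠ k in (F : Filter ℕ), H.E s t ∧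
      (U k s : ℝ) = 1 / ((k:ℝ) + 1) * w s t + (1 - 1 / ((k:ℝ) + 1)) * (U k t : ℝ) := by
    intro s
    exact Ultrafilter.eventually_exists_iff.1 (Filter.Eventually.of_forall fun k => hU k s)
  choose τ hτ using hex
  have hτE : ∀ s, H.E s (τ s) := fun s => by
    obtain ⟨k, hk⟩ := (hτ s).exists
    exact hk.1
  have hτu : ∀ s, u (τ s) = u s := fun s =>
    tendsto_nhds_unique_of_eventuallyEq (hlimE s (τ s)) (hLs s)
      ((hτ s).mono fun k hk => hk.2.symm)
  refine ⟨u, fun s => (L s).2.1, ?_⟩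
  intro ε hε
  have hclose : ∀ᶠ k in (F : Filter ℕ), ∀ s, |(U k s : ℝ) - u s| < ε := by
    rw [Filter.eventually_all]
    intro s
    have := (hLs s).eventually (Metric.ball_mem_nhds (u s) hε)
    simpa [Metric.mem_ball, Real.dist_eq] using this
  obtain ⟨k, hk, hkτ⟩ := (hclose.and (Filter.eventually_all.2 hτ)).exists
  set l : ℝ := 1 / ((k:ℝ) + 1) with hldef
  have hl0 : 0 < l := (hl k).1
  have up : ∀ s t, l * w s t + (1 - l) * (U k t : ℝ) ≤ U k s →
      w s t + (U k t : ℝ) / l ≤ U k s / l + U k t := by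
    intro s t h
    have e : U k s / l + U k t - (w s t + (U k t : ℝ) / l) =
      (U k s - (l * w s t + (1 - l) * (U k t : ℝ))) / l := by field_simp; ring
    have : 0 ≤ (U k s - (l * w s t + (1 - l) * (U k t : ℝ))) / l :=
      div_nonneg (by linarith) hl0.le
    linarith
  have dn : ∀ s t, (U k s : ℝ) ≤ l * w s t + (1 - l) * (U k t : ℝ) →
      U k s / l + U k t ≤ w s t + (U k t : ℝ) / l := by
    intro s t h
    have e : (w s t + (U k t : ℝ) / l) - (U k s / l + U k t) =
      ((l * w s t + (1 - l) * (U k t : ℝ)) - U k s) / l := by field_simp; ring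
    have : 0 ≤ ((l * w s t + (1 - l) * (U k t : ℝ)) - U k s) / l :=
      div_nonneg (by linarith) hl0.le
    linarith
  refine ⟨fun s => U k s / l, C / l, ?_, ?_, ?_, ?_⟩
  · intro s
    exact ⟨div_nonneg (U k s).2.1 hl0.le, div_le_div_of_nonneg_right (U k s).2.2 hl0.le⟩
  · intro s
    have h := hkτ s
    have a := up s (τ s) h.2.ge
    have b := dn s (τ s) h.2.le
    have c := abs_lt.1 (hk (τ s))
    have d := hτu s
    refine ⟨τ s, hτE s, d, ?_, ?_⟩ <;> dsimp only <;> linarith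
  · intro s hs t ht
    have m : u t ≤ u s := le_of_tendsto_of_tendsto (hlimE s t) (hLs s)
      (Filter.Eventually.of_forall fun k => hU1 k s hs t ht)
    have a := up s t (hU1 k s hs t ht)
    have c := abs_lt.1 (hk t)
    refine ⟨m, ?_⟩
    dsimp only; linarith
  · intro s hs t ht
    have m : u s ≤ u t := le_of_tendsto_of_tendsto (hLs s) (hlimE s t)
      (Filter.Eventually.of_forall fun k => hU2 k s hs t ht)
    have a := dn s t (hU2 k s hs t ht)
    have c := abs_lt.1 (hk t)
    refine ⟨m, ?_⟩
    dsimp only; linarith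

theorem aux_outcome_edge {S : Type} (H : GameGraph S) (π1 : Strat H H.S1) (π2 : Strat H H.S2)
    (n : ℕ) : H.E (H.outcome π1 π2 n) (H.outcome π1 π2 (n + 1)) := by
  simp only [GameGraph.outcome, GameGraph.hist]
  split_ifs with h
  · exact π1.valid _ _ h
  · exact π2.valid _ _ (by by_contra h'; exact h ((H.partition _).2 h'))

theorem aux_avg_bdd {S : Type} (w : S → S → ℤ) (C : ℝ)
    (hw0 : ∀ s t, 0 ≤ w s t) (hwC : ∀ s t, (w s t : ℝ) ≤ C) (ρ : ℕ → S) (n : ℕ) :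
    0 ≤ (∑ i ∈ Finset.range n, (w (ρ i) (ρ (i + 1)) : ℝ)) / (n : ℝ) ∧
    (∑ i ∈ Finset.range n, (w (ρ i) (ρ (i + 1)) : ℝ)) / (n : ℝ) ≤ |C| := by
  constructor
  · apply div_nonneg _ (by positivity)
    exact Finset.sum_nonneg fun i _ => by exact_mod_cast hw0 _ _
  · apply div_le_of_le_mul₀ (by positivity) (abs_nonneg _)
    calc _ ≤ ∑ i ∈ Finset.range n, |C| := Finset.sum_le_sum fun i _ => (hwC _ _).trans (le_abs_self _)
      _ = _ := by simp [mul_comm]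

theorem aux_le_limAvg {S : Type} (w : S → S → ℤ) (C : ℝ)
    (hw0 : ∀ s t, 0 ≤ w s t) (hwC : ∀ s t, (w s t : ℝ) ≤ C) (ρ : ℕ → S) (v K : ℝ)
    (h : ∀ n : ℕ, n * v - K ≤ ∑ i ∈ Finset.range n, (w (ρ i) (ρ (i + 1)) : ℝ)) :
    v ≤ limAvg w ρ := by
  have ht : Filter.Tendsto (fun n : ℕ => v - K / (n:ℝ)) Filter.atTop (nhds v) := by
    simpa using (tendsto_const_nhds (x := v)).sub (tendsto_const_div_atTop_nhds_zero_nat K)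
  rw [← ht.liminf_eq]
  apply Filter.liminf_le_liminf
  · filter_upwards [Filter.eventually_gt_atTop 0] with n hn
    have hn' : (0:ℝ) < n := by exact_mod_cast hn
    rw [le_div_iff₀ hn']
    have := h n
    have e : (v - K / n) * n = n * v - K := by field_simp
    linarith
  · exact ht.isBoundedUnder_ge
  · exact Filter.IsBoundedUnder.isCoboundedUnder_ge
      ⟨|C|, by simpa using ⟨0, fun n _ => (aux_avg_bdd w C hw0 hwC ρ n).2⟩⟩

theorem aux_limAvg_le {S : Type} (w : S → S → ℤ) (C : ℝ)
    (hw0 : ∀ s t, 0 ≤ w s t) (hwC : ∀ s t, (w s t : ℝ) ≤ C) (ρ : ℕ → S) (v K : ℝ)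
    (h : ∀ n : ℕ, ∑ i ∈ Finset.range n, (w (ρ i) (ρ (i + 1)) : ℝ) ≤ n * v + K) :
    limAvg w ρ ≤ v := by
  have ht : Filter.Tendsto (fun n : ℕ => v + K / (n:ℝ)) Filter.atTop (nhds v) := by
    simpa using (tendsto_const_nhds (x := v)).add (tendsto_const_div_atTop_nhds_zero_nat K)
  rw [← ht.liminf_eq]
  apply Filter.liminf_le_liminf
  · filter_upwards [Filter.eventually_gt_atTop 0] with n hn
    have hn' : (0:ℝ) < n := by exact_mod_cast hn
    rw [div_le_iff₀ hn']
    have := h n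
    have e : (v + K / n) * n = n * v + K := by field_simp
    linarith
  · exact ⟨0, by simpa using ⟨0, fun n _ => (aux_avg_bdd w C hw0 hwC ρ n).1⟩⟩
  · exact ht.isCoboundedUnder_ge

/-- The certificate value is below the lower value of the game; Player-2 certificates. -/
theorem aux_value {S : Type} [Finite S] (H : GameGraph S) (w : S → S → ℤ)
    (hw0 : ∀ s t, 0 ≤ w s t) :
    ∃ u : S → ℝ, (∀ s, 0 ≤ u s) ∧ ((u H.init : ℝ) : EReal) ≤ H.supInf (limAvg w) ∧
      ∀ ε : ℝ, 0 < ε → ∃ V : S → ℝ, (∀ s, 0 ≤ V s) ∧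
      (∀ s ∈ H.S1, ∀ t, H.E s t → u t ≤ u s ∧ w s t + V t ≤ V s + u s + ε) ∧
      (∀ s, ∃ t, H.E s t ∧ u t ≤ u s ∧ w s t + V t ≤ V s + u s + ε) := by
  obtain ⟨C, hC, hwC⟩ : ∃ C : ℝ, 0 ≤ C ∧ ∀ s t, (w s t : ℝ) ≤ C := by
    obtain ⟨C, hC⟩ := (Set.finite_range fun p : S × S => (w p.1 p.2 : ℝ)).bddAbove
    exact ⟨max C 0, le_max_right _ _, fun s t => (hC ⟨(s, t), rfl⟩).trans (le_max_left _ _)⟩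
  obtain ⟨u, hu0, hu⟩ := aux_cert H w C hC hw0 hwC
  refine ⟨u, hu0, ?_, ?_⟩
  · have key : ∀ ε : ℝ, 0 < ε → ((u H.init - ε : ℝ) : EReal) ≤ H.supInf (limAvg w) := by
      intro ε hε
      obtain ⟨V, D, hV, hτ, -, h2⟩ := hu ε hε
      choose τ hE hτu _ hτV using hτ
      let π1 : Strat H H.S1 := ⟨fun _ s => τ s, fun _ s _ => hE s⟩
      refine le_iSup_of_le π1 (le_iInf fun π2 => ?_)
      rw [EReal.coe_le_coe_iff]
      apply aux_le_limAvg w C hw0 hwC _ _ D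
      set ρ := H.outcome π1 π2 with hρ
      have step : ∀ n, u (ρ n) ≤ u (ρ (n+1)) ∧
          V (ρ n) + u (ρ n) - ε ≤ w (ρ n) (ρ (n+1)) + V (ρ (n+1)) := by
        intro n
        by_cases h : ρ n ∈ H.S1
        · have e : ρ (n+1) = τ (ρ n) := by
            have h' : (H.hist π1 π2 n).2 ∈ H.S1 := h
            simp only [hρ, GameGraph.outcome, GameGraph.hist, if_pos h', π1]
          rw [e]
          exact ⟨(hτu _).ge, hτV _⟩
        · exact h2 _ (by by_contra h'; exact h ((H.partition _).2 h')) _ (aux_outcome_edge H π1 π2 n)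
      have inv : ∀ n : ℕ, u H.init ≤ u (ρ n) ∧ n * (u H.init - ε) + V H.init ≤
          ∑ i ∈ Finset.range n, (w (ρ i) (ρ (i + 1)) : ℝ) + V (ρ n) := by
        intro n
        induction n with
        | zero => simp [hρ, GameGraph.outcome, GameGraph.hist]
        | succ n ih =>
          have := step n
          rw [Finset.sum_range_succ]
          push_cast
          exact ⟨by linarith, by linarith⟩
      intro n
      have := (inv n).2
      have := (hV (ρ n)).2
      have := (hV H.init).1
      linarith
    refine EReal.ge_of_forall_gt_iff_ge.1 ?_
    intro z hz
    have hz' : z < u H.init := by exact_mod_cast hz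
    have := key (u H.init - z) (by linarith)
    simpa using this
  · intro ε hε
    obtain ⟨V, D, hV, hτ, h1, -⟩ := hu ε hε
    refine ⟨V, fun s => (hV s).1, h1, fun s => ?_⟩
    obtain ⟨t, a, b, c, -⟩ := hτ s
    exact ⟨t, a, b.le, c⟩

/-- Player-2 strategies with memory. -/
theorem aux_memory {S M : Type} (H : GameGraph S) (m0 : M) (nxt : M → S → S) (upd : M → S → M)
    (hn : ∀ m, ∀ s ∈ H.S2, H.E s (nxt m s)) :
    ∃ π2 : Strat H H.S2, ∀ π1 : Strat H H.S1, ∃ m : ℕ → M, m 0 = m0 ∧ ∀ n,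
      (H.outcome π1 π2 n ∈ H.S2 →
        H.outcome π1 π2 (n+1) = nxt (m n) (H.outcome π1 π2 n) ∧
        m (n+1) = upd (m n) (H.outcome π1 π2 n)) ∧
      (H.outcome π1 π2 n ∈ H.S1 → m (n+1) = m n) := by
  let upd' : M → S → M := fun m s => if s ∈ H.S2 then upd m s else m
  let π2 : Strat H H.S2 := ⟨fun h s => nxt (h.foldl upd' m0) s, fun h s hs => hn _ s hs⟩
  refine ⟨π2, fun π1 => ⟨fun n => (H.hist π1 π2 n).1.foldl upd' m0, rfl, fun n => ⟨?_, ?_⟩⟩⟩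
  · intro h
    have h' : (H.hist π1 π2 n).2 ∉ H.S1 := fun h' => (H.partition _).1 h' h
    have h'' : (H.hist π1 π2 n).2 ∈ H.S2 := h
    constructor
    · simp only [GameGraph.outcome, GameGraph.hist, if_neg h', π2]
    · simp [GameGraph.outcome, GameGraph.hist, upd', h'']
  · intro h
    have h' : (H.hist π1 π2 n).2 ∉ H.S2 := (H.partition _).1 h
    simp [GameGraph.hist, upd', h']

instance aux_finite_GS {Q Q' Act : Type} [Finite Q] [Finite Q'] [Finite Act] :
    Finite (GS Q Q' Act) := by
  let f : GS Q Q' Act → Option (Q × Option Act × Q') := fun x =>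
    match x with
    | .err => none
    | .st q a q' => some (q, a, q')
  apply Finite.of_injective f
  intro x y h
  cases x <;> cases y <;> simp_all [f]

theorem aux_gw_nonneg {Q Q' Act : Type} (X : IA Q Act)
    (wX : Q → Act → Q → ℕ) (wY : Q' → Act → Q' → ℕ) (W : ℕ) (x y : GS Q Q' Act) :
    0 ≤ gameWeight X wX wY W x y := by
  unfold gameWeight
  split
  · positivity
  · positivity
  · split_ifs <;> positivity
  · exact le_rfl

theorem aux_maxW_bdd {Act : Type} [Finite Act] {DO DI : Set Act}
    (MO : ErrorModel Act DO) (MI : ErrorModel Act DI) :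
    BddAbove {n : ℕ | (∃ a b, MO.M a b = some n) ∨ (∃ a b, MI.M a b = some n)} := by
  apply Set.Finite.bddAbove
  apply Set.Finite.subset
    ((Set.finite_range fun p : Act × Act => (MO.M p.1 p.2).getD 0).union
      (Set.finite_range fun p : Act × Act => (MI.M p.1 p.2).getD 0))
  rintro n (⟨a, b, h⟩ | ⟨a, b, h⟩)
  · exact Or.inl ⟨(a, b), by simp [h]⟩
  · exact Or.inr ⟨(a, b), by simp [h]⟩

theorem aux_mw_mem {Q Act : Type} {D : Set Act} (F : IA Q Act) (M : ErrorModel Act D)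
    {s : Q} {b : Act} {t : Q} (hb : b ∈ D) (h : (F.modify M).delta s b t) :
    ∃ a, F.delta s a t ∧ M.M a b = some (F.mweight M s b t) := by
  have hne : {n : ℕ | ∃ a, F.delta s a t ∧ M.M a b = some n}.Nonempty := by
    rcases h with h | ⟨a, ha, hM⟩
    · exact absurd hb h.1
    · obtain ⟨n, hn⟩ := Option.ne_none_iff_exists'.1 hM
      exact ⟨n, a, ha, hn⟩
  exact Nat.sInf_mem hne

theorem aux_mw_le {Q Act : Type} {D : Set Act} (F : IA Q Act) (M : ErrorModel Act D)
    (W : ℕ) (hW : ∀ a b n, M.M a b = some n → n ≤ W) (s : Q) (b : Act) (t : Q) :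
    F.mweight M s b t ≤ W := by
  by_cases hne : {n : ℕ | ∃ a, F.delta s a t ∧ M.M a b = some n}.Nonempty
  · obtain ⟨a, _, h⟩ := Nat.sInf_mem hne
    exact hW a b _ h
  · rw [Set.not_nonempty_iff_eq_empty] at hne
    simp [IA.mweight, hne]

theorem aux_compose {Q Act : Type} {D : Set Act} (F : IA Q Act) (M : ErrorModel Act D)
    {s : Q} {b c : Act} {t : Q} {x : ℕ} (hb : b ∈ D) (h : (F.modify M).delta s b t)
    (hM : M.M b c = some x) :
    (F.modify M).delta s c t ∧ F.mweight M s c t ≤ x + F.mweight M s b t := by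
  obtain ⟨a, ha, hab⟩ := aux_mw_mem F M hb h
  obtain ⟨z, hz, hac⟩ := M.triangle a b c _ _ hab hM
  refine ⟨Or.inr ⟨a, ha, by simp [hac]⟩, ?_⟩
  have : F.mweight M s c t ≤ z := Nat.sInf_le ⟨a, ha, hac⟩
  omega

theorem aux_unmod {Q Act : Type} {D : Set Act} (F : IA Q Act) (M : ErrorModel Act D)
    {s : Q} {b : Act} {t : Q} (hb : b ∉ D) : (F.modify M).delta s b t ↔ F.delta s b t := by
  constructor
  · rintro (h | ⟨a, _, h⟩)
    · exact h.2
    · exact absurd (M.dom _ _ h).2 hb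
  · exact fun h => Or.inl ⟨hb, h⟩

/-- A local certificate for Player 2 in the simulation game. -/
structure AuxCert {Q Q' Act : Type} {AI AO : Set Act} (F : IA Q Act) (MO : ErrorModel Act AO)
    (F' : IA Q' Act) (MI : ErrorModel Act AI) (a : ℝ)
    (P : GS Q Q' Act → Prop) (V : GS Q Q' Act → ℝ) : Prop where
  nonneg : ∀ x, 0 ≤ V x
  init : P (.st F.init none F'.init)
  p1_in : ∀ s σ t s', σ ∈ AI → F.delta s σ t → P (.st s none s') →
    P (.st t (some σ) s') ∧ V (.st t (some σ) s') ≤ V (.st s none s') + a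
  p1_out : ∀ s σ s' t', σ ∈ AO → F'.delta s' σ t' → P (.st s none s') →
    P (.st s (some σ) t') ∧ V (.st s (some σ) t') ≤ V (.st s none s') + a
  p2_in : ∀ t σ s', σ ∈ AI → P (.st t (some σ) s') → ∃ t', (F'.modify MI).delta s' σ t' ∧
    P (.st t none t') ∧
    2 * (F'.mweight MI s' σ t' : ℝ) + V (.st t none t') ≤ V (.st t (some σ) s') + a
  p2_out : ∀ s σ t', σ ∈ AO → P (.st s (some σ) t') → ∃ t, (F.modify MO).delta s σ t ∧
    P (.st t none t') ∧
    2 * (F.mweight MO s σ t : ℝ) + V (.st t none t') ≤ V (.st s (some σ) t') + a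

theorem aux_cert_exists {Q Q' Act : Type} [Finite Q] [Finite Q'] [Finite Act]
    {AI AO : Set Act} (hd : ∀ σ, σ ∈ AI → σ ∈ AO → False)
    (F : IA Q Act) (F' : IA Q' Act)
    (hAI : F.AI = AI) (hAO' : F'.AO = AO)
    (MO : ErrorModel Act AO) (MI : ErrorModel Act AI) :
    ∃ v : ℝ, 0 ≤ v ∧ (v : EReal) ≤ distLimAvg F MO F' MI ∧
      ∀ ε : ℝ, 0 < ε → v + ε < maxW MO MI → ∃ P V, AuxCert F MO F' MI (v + ε) P V := by
  obtain ⟨u, hu0, hle, hcert⟩ := aux_value (simGame (F.modify MO) (F'.modify MI))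
    (gameWeight (F.modify MO) (F.mweight MO) (F'.mweight MI) (maxW MO MI))
    (aux_gw_nonneg _ _ _ _)
  refine ⟨u _, hu0 _, hle, ?_⟩
  set v := u (simGame (F.modify MO) (F'.modify MI)).init with hv
  intro ε hε hW
  obtain ⟨V, hV0, hV1, hV2⟩ := hcert ε hε
  have herr : ¬ u .err ≤ v := by
    intro h
    have := (hV1 .err (by simp [simGame, GS.isP2]) .err
      (Or.inr (Or.inr ⟨by simp [GS.isP2], by intro z; simp [rawEdge], rfl⟩))).2
    simp only [gameWeight] at this
    push_cast at this
    linarith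
  have hXI : (F.modify MO).AI = AI := hAI
  have hYO : (F'.modify MI).AO = AO := hAO'
  refine ⟨fun x => u x ≤ v, V, hV0, le_rfl, ?_, ?_, ?_, ?_⟩
  · intro s σ t s' hσ hδ hP
    have h := hV1 (.st s none s') (by simp [simGame, GS.isP2]) (.st t (some σ) s')
      (Or.inl (Or.inl ⟨hXI ▸ hσ, (aux_unmod F MO (fun h => hd _ hσ h)).2 hδ, rfl⟩))
    simp only [gameWeight] at h
    push_cast at h
    exact ⟨h.1.trans hP, by linarith⟩
  · intro s σ s' t' hσ hδ hP
    have h := hV1 (.st s none s') (by simp [simGame, GS.isP2]) (.st s (some σ) t')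
      (Or.inl (Or.inr ⟨hYO ▸ hσ, (aux_unmod F' MI (fun h => hd _ h hσ)).2 hδ, rfl⟩))
    simp only [gameWeight] at h
    push_cast at h
    exact ⟨h.1.trans hP, by linarith⟩
  · intro t σ s' hσ hP
    obtain ⟨y, hE, huy, hwy⟩ := hV2 (.st t (some σ) s')
    have hy : u y ≤ v := huy.trans hP
    rcases hE with hE | ⟨_, _, rfl⟩ | ⟨h, _⟩
    · rcases y with _ | ⟨q, _ | τ, q'⟩
      · exact absurd hy herr
      · rcases hE with ⟨_, hδ, rfl⟩ | ⟨h, _⟩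
        · refine ⟨q', hδ, hy, ?_⟩
          simp only [gameWeight, hXI, if_pos hσ] at hwy
          push_cast at hwy
          linarith
        · exact (hd _ hσ (hYO ▸ h)).elim
      · exact hE.elim
    · exact absurd hy herr
    · exact absurd trivial h
  · intro s σ t' hσ hP
    obtain ⟨y, hE, huy, hwy⟩ := hV2 (.st s (some σ) t')
    have hy : u y ≤ v := huy.trans hP
    have hσ' : σ ∉ AI := fun h => hd _ h hσ
    rcases hE with hE | ⟨_, _, rfl⟩ | ⟨h, _⟩
    · rcases y with _ | ⟨q, _ | τ, q'⟩
      · exact absurd hy herr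
      · rcases hE with ⟨h, _⟩ | ⟨_, hδ, rfl⟩
        · exact (hσ' (hXI ▸ h)).elim
        · refine ⟨q, hδ, hy, ?_⟩
          simp only [gameWeight, hXI, if_neg hσ'] at hwy
          push_cast at hwy
          linarith
      · exact hE.elim
    · exact absurd hy herr
    · exact absurd trivial h

/-- Every play of the simulation game has limit average at most `maxW`. -/
theorem aux_limAvg_le_W {Q Q' Act : Type} {X : IA Q Act} {Y : IA Q' Act}
    (wX : Q → Act → Q → ℕ) (wY : Q' → Act → Q' → ℕ) (W : ℕ)
    (hX : ∀ s b t, wX s b t ≤ W) (hY : ∀ s b t, wY s b t ≤ W)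
    (ρ : ℕ → GS Q Q' Act) (hρ : ∀ n, (simGame X Y).E (ρ n) (ρ (n+1))) :
    limAvg (gameWeight X wX wY W) ρ ≤ W := by
  have hX' : ∀ s b t, (wX s b t : ℤ) ≤ W := fun s b t => by exact_mod_cast hX s b t
  have hY' : ∀ s b t, (wY s b t : ℤ) ≤ W := fun s b t => by exact_mod_cast hY s b t
  have hW0 : (0:ℤ) ≤ W := by positivity
  have hC : ∀ x y, gameWeight X wX wY W x y ≤ 2 * W := by
    intro x y
    unfold gameWeight
    split
    · linarith
    · linarith
    · split_ifs
      · exact mul_le_mul_of_nonneg_left (hY' _ _ _) (by norm_num)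
      · exact mul_le_mul_of_nonneg_left (hX' _ _ _) (by norm_num)
    · positivity
  let p : GS Q Q' Act → ℤ := fun x => if x.isP2 then W else 0
  have hp : ∀ x, 0 ≤ p x ∧ p x ≤ W := by
    intro x
    simp only [p]
    split_ifs <;> simp
  have step : ∀ x y, (simGame X Y).E x y → gameWeight X wX wY W x y ≤ W + p x - p y := by
    intro x y h
    rcases x with _ | ⟨s, _ | σ, s'⟩
    · have : y = .err := by
        rcases h with h | ⟨h, _⟩ | ⟨_, _, h⟩
        · exact (by simpa [rawEdge] using h)
        · exact h.elim
        · exact h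
      subst this
      simp [gameWeight]
    · rcases h with h | ⟨h, _⟩ | ⟨_, _, rfl⟩
      · rcases y with _ | ⟨t, _ | τ, t'⟩
        · exact h.elim
        · exact h.elim
        · simp [gameWeight, p, GS.isP2]
      · exact h.elim
      · simp [gameWeight]
    · have hy : p y = 0 := by
        rcases h with h | ⟨_, _, rfl⟩ | ⟨h, _⟩
        · rcases y with _ | ⟨t, _ | τ, t'⟩
          · exact h.elim
          · simp [p, GS.isP2]
          · exact h.elim
        · simp [p, GS.isP2]
        · exact absurd trivial h
      have := hC (.st s (some σ) s') y
      have hx : p (.st s (some σ) s') = W := by simp [p, GS.isP2]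
      rw [hx, hy]
      linarith
  apply aux_limAvg_le _ (2 * W) (aux_gw_nonneg _ _ _ _) (fun s t => by exact_mod_cast hC s t) _ _ W
  intro n
  have inv : ∑ i ∈ Finset.range n, gameWeight X wX wY W (ρ i) (ρ (i+1)) ≤ n * W + p (ρ 0) - p (ρ n) := by
    induction n with
    | zero => simp
    | succ n ih =>
      rw [Finset.sum_range_succ]
      have := step _ _ (hρ n)
      push_cast
      linarith
  have h2 : ∑ i ∈ Finset.range n, gameWeight X wX wY W (ρ i) (ρ (i+1)) ≤ n * W + W := by
    have := (hp (ρ 0)).2; have := (hp (ρ n)).1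
    linarith
  exact_mod_cast h2

/-- The invariant for the composed strategy. -/
def AuxGood {Q1 Q2 Q3 Act : Type} (AI AO : Set Act)
    (P12 : GS Q1 Q2 Act → Prop) (V12 : GS Q1 Q2 Act → ℝ) (a : ℝ)
    (P23 : GS Q2 Q3 Act → Prop) (V23 : GS Q2 Q3 Act → ℝ) (b : ℝ) (m : Q2) :
    GS Q1 Q3 Act → ℝ → Prop
  | .err, _ => False
  | .st s none t, B => P12 (.st s none m) ∧ P23 (.st m none t) ∧
      V12 (.st s none m) + V23 (.st m none t) ≤ B
  | .st s (some σ) t, B =>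
      (σ ∈ AI ∧ P12 (.st s (some σ) m) ∧ P23 (.st m none t) ∧
        V12 (.st s (some σ) m) + V23 (.st m none t) + b ≤ B) ∨
      (σ ∈ AO ∧ P12 (.st s none m) ∧ P23 (.st m (some σ) t) ∧
        V12 (.st s none m) + V23 (.st m (some σ) t) + a ≤ B)

theorem aux_main_s4 {Q1 Q2 Q3 Act : Type} [Finite Q1] [Finite Q2] [Finite Q3] [Finite Act]
    {AI AO : Set Act} (hd : ∀ σ, σ ∈ AI → σ ∈ AO → False)
    (F1 : IA Q1 Act) (F2 : IA Q2 Act) (F3 : IA Q3 Act)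
    (hAI1 : F1.AI = AI) (hAO3 : F3.AO = AO)
    (MO : ErrorModel Act AO) (MI : ErrorModel Act AI)
    (P12 : GS Q1 Q2 Act → Prop) (V12 : GS Q1 Q2 Act → ℝ) (a : ℝ) (ha : 0 ≤ a)
    (P23 : GS Q2 Q3 Act → Prop) (V23 : GS Q2 Q3 Act → ℝ) (b : ℝ) (hb : 0 ≤ b)
    (C12 : AuxCert F1 MO F2 MI a P12 V12) (C23 : AuxCert F2 MO F3 MI b P23 V23) :
    distLimAvg F1 MO F3 MI ≤ ((a + b : ℝ) : EReal) := by
  set H := simGame (F1.modify MO) (F3.modify MI) with hH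
  set w := gameWeight (F1.modify MO) (F1.mweight MO) (F3.mweight MI) (maxW MO MI) with hw
  have hXI : (F1.modify MO).AI = AI := hAI1
  have hYO : (F3.modify MI).AO = AO := hAO3
  let G := AuxGood AI AO P12 V12 a P23 V23 b
  have L1 : ∀ m s t B, s ∈ H.S1 → H.E s t → G m s B → G m t (B + (a + b) - w s t) := by
    intro m s t B hs hE hG
    rcases s with _ | ⟨s1, _ | σ, s3⟩
    · exact hG.elim
    · obtain ⟨g1, g2, g3⟩ := hG
      rcases hE with hE | ⟨h, _⟩ | ⟨_, _, rfl⟩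
      · rcases t with _ | ⟨t1, _ | σ, t3⟩
        · exact hE.elim
        · exact hE.elim
        · have hw0 : w (.st s1 none s3) (.st t1 (some σ) t3) = 0 := by simp [hw, gameWeight]
          rw [hw0]
          rcases hE with ⟨hσ, hδ, rfl⟩ | ⟨hσ, hδ, rfl⟩
          · rw [hXI] at hσ
            rw [aux_unmod F1 MO (fun h => hd _ hσ h)] at hδ
            obtain ⟨c1, c2⟩ := C12.p1_in _ _ _ _ hσ hδ g1
            refine Or.inl ⟨hσ, c1, g2, ?_⟩
            push_cast
            linarith
          · rw [hYO] at hσ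
            rw [aux_unmod F3 MI (fun h => hd _ h hσ)] at hδ
            obtain ⟨c1, c2⟩ := C23.p1_out _ _ _ _ hσ hδ g2
            refine Or.inr ⟨hσ, g1, c1, ?_⟩
            push_cast
            linarith
      · exact h.elim
      · have hw0 : w (.st s1 none s3) (.st s1 none s3) = 0 := by simp [hw, gameWeight]
        rw [hw0]
        refine ⟨g1, g2, ?_⟩
        push_cast
        linarith
    · exact absurd trivial hs
  have L2 : ∀ m s, ∃ t m', s ∈ H.S2 → H.E s t ∧
      ∀ B, G m s B → G m' t (B + (a + b) - w s t) := by
    intro m s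
    by_cases hex : ∃ B, G m s B
    · rcases s with _ | ⟨s1, _ | σ, s3⟩
      · exact ⟨.err, m, fun h => h.elim⟩
      · exact ⟨.err, m, fun h => h.elim⟩
      · by_cases hσ : σ ∈ AI
        · have hσ' : σ ∉ AO := fun h => hd _ hσ h
          obtain ⟨B0, ⟨_, g1, g2, _⟩ | ⟨h, _⟩⟩ := hex
          · obtain ⟨m', d2, p2, v2⟩ := C12.p2_in _ _ _ hσ g1
            obtain ⟨σ', e2, hM⟩ := aux_mw_mem F2 MI hσ d2
            have hσ2 : σ' ∈ AI := (MI.dom σ' σ (by simp [hM])).1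
            obtain ⟨q1, q2⟩ := C23.p1_in _ _ _ _ hσ2 e2 g2
            obtain ⟨t3, d3, p3, v3⟩ := C23.p2_in _ _ _ hσ2 q1
            obtain ⟨d, hle⟩ := aux_compose F3 MI hσ2 d3 hM
            have hle' : (F3.mweight MI s3 σ t3 : ℝ) ≤
              F2.mweight MI m σ m' + F3.mweight MI s3 σ' t3 := by exact_mod_cast hle
            refine ⟨.st s1 none t3, m', fun _ => ⟨Or.inl (Or.inl ⟨hXI ▸ hσ, d, rfl⟩), ?_⟩⟩
            rintro B (⟨_, _, _, hB⟩ | ⟨h, _⟩)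
            · refine ⟨p2, p3, ?_⟩
              simp only [hw, gameWeight, hXI, if_pos hσ]
              push_cast
              linarith
            · exact (hσ' h).elim
          · exact (hσ' h).elim
        · obtain ⟨B0, ⟨h, _⟩ | ⟨hO, g1, g2, _⟩⟩ := hex
          · exact (hσ h).elim
          · obtain ⟨m', d2, p2, v2⟩ := C23.p2_out _ _ _ hO g2
            obtain ⟨σ', e2, hM⟩ := aux_mw_mem F2 MO hO d2
            have hσ2 : σ' ∈ AO := (MO.dom σ' σ (by simp [hM])).1
            obtain ⟨q1, q2⟩ := C12.p1_out _ _ _ _ hσ2 e2 g1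
            obtain ⟨t1, d3, p3, v3⟩ := C12.p2_out _ _ _ hσ2 q1
            obtain ⟨d, hle⟩ := aux_compose F1 MO hσ2 d3 hM
            have hle' : (F1.mweight MO s1 σ t1 : ℝ) ≤
              F2.mweight MO m σ m' + F1.mweight MO s1 σ' t1 := by exact_mod_cast hle
            refine ⟨.st t1 none s3, m', fun _ => ⟨Or.inl (Or.inr ⟨hYO ▸ hO, d, rfl⟩), ?_⟩⟩
            rintro B (⟨h, _⟩ | ⟨_, _, _, hB⟩)
            · exact (hσ h).elim
            · refine ⟨p3, p2, ?_⟩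
              simp only [hw, gameWeight, hXI, if_neg hσ]
              push_cast
              linarith
    · obtain ⟨t, ht⟩ := H.serial s
      exact ⟨t, m, fun _ => ⟨ht, fun B hB => (hex ⟨B, hB⟩).elim⟩⟩
  have L3 : ∀ m s B, G m s B → 0 ≤ B := by
    intro m s B hG
    rcases s with _ | ⟨s1, _ | σ, s3⟩
    · exact hG.elim
    · have := C12.nonneg (.st s1 none m); have := C23.nonneg (.st m none s3)
      linarith [hG.2.2]
    · rcases hG with ⟨_, _, _, h⟩ | ⟨_, _, _, h⟩
      · have := C12.nonneg (.st s1 (some σ) m); have := C23.nonneg (.st m none s3)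
        linarith
      · have := C12.nonneg (.st s1 none m); have := C23.nonneg (.st m (some σ) s3)
        linarith
  choose nxt upd hnu using L2
  obtain ⟨π2, hπ2⟩ := aux_memory H F2.init nxt upd (fun m s hs => (hnu m s hs).1)
  refine iSup_le fun π1 => iInf_le_of_le π2 ?_
  rw [EReal.coe_le_coe_iff]
  obtain ⟨m, hm0, hm⟩ := hπ2 π1
  set ρ := H.outcome π1 π2 with hρ
  obtain ⟨C, hC⟩ := (Set.finite_range
    fun p : GS Q1 Q3 Act × GS Q1 Q3 Act => (w p.1 p.2 : ℝ)).bddAbove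
  let K := V12 (.st F1.init none F2.init) + V23 (.st F2.init none F3.init)
  apply aux_limAvg_le w C (aux_gw_nonneg _ _ _ _) (fun s t => hC ⟨(s, t), rfl⟩) ρ _ K
  intro n
  have inv : G (m n) (ρ n) (n * (a + b) + K - ∑ i ∈ Finset.range n, (w (ρ i) (ρ (i + 1)) : ℝ)) := by
    induction n with
    | zero =>
      rw [hm0]
      refine ⟨C12.init, C23.init, ?_⟩
      simp only [Nat.cast_zero, zero_mul, zero_add, Finset.range_zero, Finset.sum_empty, sub_zero]
      exact le_rfl
    | succ n ih =>
      have e : (((n + 1 : ℕ) : ℝ) * (a + b) + K -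
          ∑ i ∈ Finset.range (n + 1), (w (ρ i) (ρ (i + 1)) : ℝ)) =
          (n * (a + b) + K - ∑ i ∈ Finset.range n, (w (ρ i) (ρ (i + 1)) : ℝ)) + (a + b)
            - w (ρ n) (ρ (n + 1)) := by
        rw [Finset.sum_range_succ]
        push_cast
        ring
      rw [e]
      by_cases h : ρ n ∈ H.S2
      · obtain ⟨e1, e2⟩ := (hm n).1 h
        rw [e1, e2]
        exact (hnu _ _ h).2 _ ih
      · have h1 : ρ n ∈ H.S1 := (H.partition _).2 h
        rw [(hm n).2 h1]
        exact L1 _ _ _ _ h1 (aux_outcome_edge H π1 π2 n) ih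
  have := L3 _ _ _ inv
  linarith

/-- Triangle inequality for the interface simulation distance with the
limit-average objective: for BIAs `F1`, `F2`, `F3` over the same input alphabet `AI` and
output alphabet `AO`, an output error model `MO` and an input error model `MI`,
`d^{LimAvg}(F1⊗MO, F3⊗MI) ≤ d^{LimAvg}(F1⊗MO, F2⊗MI) + d^{LimAvg}(F2⊗MO, F3⊗MI)`. -/
theorem distLimAvg_triangle {Q1 Q2 Q3 Act : Type}
    [Finite Q1] [Finite Q2] [Finite Q3] [Finite Act]
    (AI AO : Set Act)
    (F1 : IA Q1 Act) (F2 : IA Q2 Act) (F3 : IA Q3 Act)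
    (h1 : F1.IsBIA) (h2 : F2.IsBIA) (h3 : F3.IsBIA)
    (hAI1 : F1.AI = AI) (hAI2 : F2.AI = AI) (hAI3 : F3.AI = AI)
    (hAO1 : F1.AO = AO) (hAO2 : F2.AO = AO) (hAO3 : F3.AO = AO)
    (MO : ErrorModel Act AO) (MI : ErrorModel Act AI) :
    distLimAvg F1 MO F3 MI ≤ distLimAvg F1 MO F2 MI + distLimAvg F2 MO F3 MI := by
  have hd : ∀ σ, σ ∈ AI → σ ∈ AO → False := by
    intro σ ha hb
    have := h1.disj
    rw [hAI1, hAO1] at this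
    exact Set.disjoint_left.1 this ha hb
  obtain ⟨v, hv0, hv, hvc⟩ := aux_cert_exists hd F1 F2 hAI1 hAO2 MO MI
  obtain ⟨v', hv0', hv', hvc'⟩ := aux_cert_exists hd F2 F3 hAI2 hAO3 MO MI
  refine le_trans ?_ (add_le_add hv hv')
  rw [← EReal.coe_add]
  have key : ∀ ε : ℝ, 0 < ε → distLimAvg F1 MO F3 MI ≤ ((v + ε + (v' + ε) : ℝ) : EReal) := by
    intro ε hε
    by_cases hW : v + ε < maxW MO MI ∧ v' + ε < maxW MO MI
    · obtain ⟨P, V, c⟩ := hvc ε hε hW.1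
      obtain ⟨P', V', c'⟩ := hvc' ε hε hW.2
      exact aux_main_s4 hd F1 F2 F3 hAI1 hAO3 MO MI P V _ (by linarith) P' V' _ (by linarith) c c'
    · have hle : (maxW MO MI : ℝ) ≤ v + ε + (v' + ε) := by
        by_contra hlt
        exact hW ⟨by linarith, by linarith⟩
      refine iSup_le fun π1 => ?_
      let π2 : Strat (simGame (F1.modify MO) (F3.modify MI))
          (simGame (F1.modify MO) (F3.modify MI)).S2 :=
        ⟨fun _ s => ((simGame (F1.modify MO) (F3.modify MI)).serial s).choose,
          fun _ s _ => ((simGame (F1.modify MO) (F3.modify MI)).serial s).choose_spec⟩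
      refine iInf_le_of_le π2 ?_
      rw [EReal.coe_le_coe_iff]
      refine le_trans (aux_limAvg_le_W _ _ _ ?_ ?_ _ (aux_outcome_edge _ π1 π2)) hle
      · exact aux_mw_le F1 MO _ fun a b n h =>
          le_csSup (aux_maxW_bdd MO MI) (Or.inl ⟨a, b, h⟩)
      · exact aux_mw_le F3 MI _ fun a b n h =>
          le_csSup (aux_maxW_bdd MO MI) (Or.inr ⟨a, b, h⟩)
  refine EReal.le_of_forall_lt_iff_le.1 ?_
  intro z hz
  have hz' : v + v' < z := by exact_mod_cast hz
  have := key ((z - (v + v')) / 2) (by linarith)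
  have e : v + (z - (v + v')) / 2 + (v' + (z - (v + v')) / 2) = z := by ring
  rwa [e] at this
end

section
/- Let F and G be composable BIAs and let MI be an input error model restricted with respect to G (for σ1 ≠ σ2, MI(σ1,σ2) ≠ ⊥ implies σ2 ∈ AI_{F∥G} \ AI_G). If F is compatible with G (F ∼ G), then the modified system F⊗MI is compatible with G (F⊗MI ∼ G). -/
open scoped Classical

/-- Compatibility is preserved under modification by a restricted input
error model: if `F` and `G` are composable BIAs, `MI` is an input error model restricted
with respect to `G`, and `F ∼ G`, then `F⊗MI ∼ G`. -/
theorem modify_in_compatible {Q R Act : Type} [Finite Q] [Finite R] [Finite Act]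
    (F : IA Q Act) (G : IA R Act) (hF : F.IsBIA) (hG : G.IsBIA)
    (hcomp : IA.Composable F G)
    (MI : ErrorModel Act F.AI) (hMI : InRestricted MI F G)
    (hcompat : IA.Compatible F G) :
    IA.Compatible (F.modify MI) G := by
  have key : ∀ σ, σ ∈ F.AO ∪ G.AO → ∀ s t, (F.modify MI).delta s σ t ↔ F.delta s σ t := by
    intro σ hσ s t
    constructor
    · rintro (⟨_, h⟩ | ⟨a, h, hM⟩)
      · exact h
      · by_cases hab : a = σ
        · exact hab ▸ h
        · exfalso
          have hI : σ ∈ F.AI := (MI.dom a σ hM).2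
          have hr : σ ∉ IA.shared F G := (hMI a σ hab hM).1.2
          rcases hσ with hσ | hσ
          · exact Set.disjoint_left.1 hF.disj hI hσ
          · exact hr ⟨Or.inl hI, Or.inr hσ⟩
    · intro h
      by_cases hI : σ ∈ F.AI
      · exact Or.inr ⟨σ, h, by simp [MI.refl σ hI]⟩
      · exact Or.inl ⟨hI, h⟩
  have step : ∀ s t, IA.outputStep (F.modify MI) G s t → IA.outputStep F G s t := by
    rintro s t ⟨σ, hσ, h⟩
    refine ⟨σ, hσ, ?_⟩
    rcases h with ⟨h1, h2, h3⟩ | h | ⟨h1, h2, h3⟩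
    · exact Or.inl ⟨h1, (key σ hσ _ _).1 h2, h3⟩
    · exact Or.inr (Or.inl h)
    · exact Or.inr (Or.inr ⟨h1, (key σ hσ _ _).1 h2, h3⟩)
  intro t ht herr
  refine hcompat t (Relation.ReflTransGen.mono step _ _ ht) ?_
  obtain ⟨σ, hs, h⟩ := herr
  refine ⟨σ, hs, ?_⟩
  rcases h with ⟨⟨h1, q, h2⟩, h3⟩ | ⟨h1, h2⟩
  · exact Or.inl ⟨⟨h1, q, (key σ (Or.inl h1) _ _).1 h2⟩, h3⟩
  · refine Or.inr ⟨h1, fun h3 => h2 ?_⟩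
    obtain ⟨h4, q, h5⟩ := h3
    exact ⟨h4, q, (key σ (Or.inr h1.1) _ _).2 h5⟩
end
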